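/- arXiv:2207.11787 — 2 statements merged into one kernel-verified Lean document; each statement's English description precedes it below -/
import Mathlib

section
/- Let (m_k)_{k∈ℕ} be a strictly increasing sequence in ℕ and let λ ∈ [0,1]. Then the set of all T ∈ Aut([0,1], ℬ, μ) for which there exists a strictly increasing sequence (k_ℓ)_{ℓ∈ℕ} in ℕ such that for all measurable A, B ⊆ [0,1], lim_{ℓ→∞} μ(A ∩ T^{−m_{k_ℓ}} B) = (1 − λ) μ(A ∩ B) + λ μ(A) μ(B), is a dense G_δ subset of Aut([0,1], ℬ, μ) in the weak topology. -/
open MeasureTheory Filter Topology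

noncomputable section

/-- An invertible Lebesgue-measure-preserving transformation of `[0,1]`. -/
structure Aut01 : Type where
  toEquiv : unitInterval ≃ unitInterval
  measurePreserving_toFun :
    MeasurePreserving toEquiv (volume : Measure unitInterval) volume
  measurePreserving_invFun :
    MeasurePreserving toEquiv.symm (volume : Measure unitInterval) volume

namespace Aut01

/-- The correlation `μ(A ∩ T^{-m} B)` (as a real number). -/
def corr (T : Aut01) (m : ℤ) (A B : Set unitInterval) : ℝ :=
  (volume (A ∩ ⇑(T.toEquiv ^ m : Equiv.Perm unitInterval) ⁻¹' B)).toReal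

/-- The dyadic interval `[k/2^ℓ, (k+1)/2^ℓ)` of rank `ℓ`, as a subset of `[0,1]`. -/
def dyadic (ℓ k : ℕ) : Set unitInterval :=
  {x | (k : ℝ) / 2 ^ ℓ ≤ (x : ℝ) ∧ (x : ℝ) < ((k : ℝ) + 1) / 2 ^ ℓ}

/-- The metric `∂(T,S) = Σ_{ℓ≥1} 2^{-2ℓ} Σ_{E of rank ℓ} μ(TE △ SE)` inducing the weak
topology on `Aut01`. -/
def wDist (T S : Aut01) : ℝ :=
  ∑' ℓ : ℕ,
    (1 / 2 ^ (2 * (ℓ + 1)) : ℝ) *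
      ∑ k ∈ Finset.range (2 ^ (ℓ + 1)),
        (volume (symmDiff (T.toEquiv '' dyadic (ℓ + 1) k) (S.toEquiv '' dyadic (ℓ + 1) k))).toReal

/-- The weak topology on `Aut01`, generated by the balls of the metric `wDist`. -/
instance : TopologicalSpace Aut01 :=
  TopologicalSpace.generateFrom
    {U | ∃ (T : Aut01) (ε : ℝ), 0 < ε ∧ U = {S | wDist T S < ε}}

/-- `T` is aperiodic: the set of periodic points has measure zero. -/
def Aperiodic (T : Aut01) : Prop :=
  volume {x : unitInterval |
    ∃ n : ℕ, 0 < n ∧ (T.toEquiv ^ n : Equiv.Perm unitInterval) x = x} = 0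

/-- `T` is weakly mixing. -/
def WeaklyMixing (T : Aut01) : Prop :=
  ∀ A B : Set unitInterval, MeasurableSet A → MeasurableSet B →
    Tendsto
      (fun M : ℕ =>
        (1 / (M : ℝ)) *
          ∑ n ∈ Finset.Icc 1 M,
            |T.corr (n : ℤ) A B - (volume A).toReal * (volume B).toReal|)
      atTop (𝓝 0)

end Aut01

namespace Aut01

open scoped ENNReal NNReal unitInterval symmDiff
open ProbabilityTheory

/-- The `L¹` distance between two maps with values in the unit interval. -/
def meanDist {Z : Type*} [MeasurableSpace Z] (μ : Measure Z) (p q : Z → I) : ℝ≥0∞ :=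
  ∫⁻ z, edist (p z) (q z) ∂μ

section MeanDist

variable {Z : Type*} [MeasurableSpace Z] {μ : Measure Z} {p q r : Z → I}

lemma meanDist_self : meanDist μ p p = 0 := by simp [meanDist]

lemma meanDist_comm : meanDist μ p q = meanDist μ q p := by simp [meanDist, edist_comm]

lemma meanDist_triangle (hp : Measurable p) (hq : Measurable q) :
    meanDist μ p r ≤ meanDist μ p q + meanDist μ q r := by
  unfold meanDist
  rw [← lintegral_add_left (hp.edist hq)]
  exact lintegral_mono fun z => edist_triangle _ _ _

lemma edist_le_one (x y : I) : edist x y ≤ 1 := by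
  rw [edist_dist, ← ENNReal.ofReal_one]
  refine ENNReal.ofReal_le_ofReal ?_
  rw [Subtype.dist_eq, Real.dist_eq, abs_le]
  constructor <;> linarith [x.2.1, x.2.2, y.2.1, y.2.2]

lemma meanDist_le_of_edist_le [IsProbabilityMeasure μ] {c : ℝ≥0∞}
    (h : ∀ᵐ z ∂μ, edist (p z) (q z) ≤ c) : meanDist μ p q ≤ c := by
  calc meanDist μ p q ≤ ∫⁻ _, c ∂μ := lintegral_mono_ae h
    _ = c := by simp

lemma meanDist_le_one [IsProbabilityMeasure μ] : meanDist μ p q ≤ 1 :=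
  meanDist_le_of_edist_le (ae_of_all _ fun _ => edist_le_one _ _)

lemma meanDist_congr {p' q' : Z → I} (hp : p =ᵐ[μ] p') (hq : q =ᵐ[μ] q') :
    meanDist μ p q = meanDist μ p' q' :=
  lintegral_congr_ae (by filter_upwards [hp, hq] with z h₁ h₂; rw [h₁, h₂])

/-- Two maps agreeing within `c` off a set `s` are within `c + μ s` in mean. -/
lemma meanDist_le_add_measure [IsProbabilityMeasure μ] {s : Set Z} (hs : MeasurableSet s)
    {c : ℝ≥0∞} (h : ∀ᵐ z ∂μ, z ∉ s → edist (p z) (q z) ≤ c) : meanDist μ p q ≤ c + μ s := by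
  calc meanDist μ p q ≤ ∫⁻ z, (c + s.indicator 1 z) ∂μ := by
        refine lintegral_mono_ae ?_
        filter_upwards [h] with z hz
        by_cases hzs : z ∈ s
        · simpa [hzs] using le_add_left (edist_le_one (p z) (q z))
        · simpa [hzs] using hz hzs
    _ = c + μ s := by
        rw [lintegral_add_left measurable_const, lintegral_indicator_one hs]; simp

lemma meanDist_comp {Y : Type*} [MeasurableSpace Y] {ν : Measure Y} {f : Y → Z}
    (hf : MeasurePreserving f ν μ) (hp : Measurable p) (hq : Measurable q) :
    meanDist ν (p ∘ f) (q ∘ f) = meanDist μ p q :=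
  hf.lintegral_comp (hp.edist hq)

end MeanDist

/-- Composing on the left with a fixed integrable function is `L¹`-continuous, uniformly over all
pairs of measure preserving maps. -/
lemma exists_lintegral_edist_comp_le {f : I → ℝ} (hf : Integrable f volume) {ε : ℝ≥0∞}
    (hε : ε ≠ 0) :
    ∃ C : ℝ≥0, ∀ {Z : Type} [MeasurableSpace Z] (μ : Measure Z) [IsProbabilityMeasure μ]
      (p q : Z → I), MeasurePreserving p μ volume → MeasurePreserving q μ volume →
      ∫⁻ z, edist (f (p z)) (f (q z)) ∂μ ≤ ε + C * meanDist μ p q := by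
  have hε3 : ε / 3 ≠ 0 := by simp [hε]
  obtain ⟨g, hg, -⟩ := hf.exists_boundedContinuous_lintegral_sub_le hε3
  have hgu : UniformContinuous g := CompactSpace.uniformContinuous_of_continuous g.continuous
  obtain ⟨d, hd, hdg⟩ := EMetric.uniformContinuous_iff.1 hgu (ε / 3) (pos_iff_ne_zero.2 hε3)
  obtain ⟨d', hd', hd'd⟩ := ENNReal.lt_iff_exists_nnreal_btwn.1 hd
  have hd0 : d' ≠ 0 := by rintro rfl; simp at hd'
  obtain ⟨M, hM⟩ : ∃ M : ℝ≥0, ∀ x y, edist (g x) (g y) ≤ M := by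
    refine ⟨‖g‖₊ + ‖g‖₊, fun x y => ?_⟩
    rw [edist_dist, ENNReal.ofReal_le_iff_le_toReal ENNReal.coe_ne_top]
    have := g.dist_le_two_norm x y
    rw [ENNReal.coe_toReal, NNReal.coe_add, coe_nnnorm]
    linarith
  refine ⟨M / d', fun {Z} _ μ _ p q hp hq => ?_⟩
  have key : ∀ x y, edist (f x) (f y) ≤ edist (f x) (g x) + edist (f y) (g y)
      + (ε / 3 + ((M / d' : ℝ≥0) : ℝ≥0∞) * edist x y) := by
    intro x y
    have h1 : edist (g x) (g y) ≤ ε / 3 + ((M / d' : ℝ≥0) : ℝ≥0∞) * edist x y := by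
      by_cases hxy : edist x y < d
      · exact le_add_right (hdg hxy).le
      · refine le_add_left ((hM x y).trans ?_)
        have : (d' : ℝ≥0∞) ≤ edist x y := hd'd.le.trans (not_lt.1 hxy)
        calc (M : ℝ≥0∞) = ((M / d' : ℝ≥0) : ℝ≥0∞) * d' := by
              rw [← ENNReal.coe_mul, div_mul_cancel₀ _ hd0]
          _ ≤ _ := by gcongr
    calc edist (f x) (f y) ≤ edist (f x) (g x) + edist (g x) (g y) + edist (g y) (f y) :=
          edist_triangle4 _ _ _ _
      _ ≤ edist (f x) (g x) + (ε / 3 + ((M / d' : ℝ≥0) : ℝ≥0∞) * edist x y)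
          + edist (g y) (f y) := by gcongr
      _ = _ := by rw [edist_comm (g y)]; ring
  have hfg : AEMeasurable (fun x => edist (f x) (g x)) volume :=
    hf.1.aemeasurable.edist g.continuous.aemeasurable
  have hI : ∀ {r : Z → I}, MeasurePreserving r μ volume →
      ∫⁻ z, edist (f (r z)) (g (r z)) ∂μ ≤ ε / 3 := by
    intro r hr
    have : ∫⁻ z, edist (f (r z)) (g (r z)) ∂μ = ∫⁻ x, edist (f x) (g x) := by
      rw [← hr.map_eq, lintegral_map' (by rwa [hr.map_eq]) hr.aemeasurable]
    rw [this]
    simpa [edist_eq_enorm_sub] using hg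
  have hpm : AEMeasurable (fun z => edist (f (p z)) (g (p z))) μ :=
    hfg.comp_quasiMeasurePreserving hp.quasiMeasurePreserving
  have hqm : AEMeasurable (fun z => edist (f (q z)) (g (q z))) μ :=
    hfg.comp_quasiMeasurePreserving hq.quasiMeasurePreserving
  calc ∫⁻ z, edist (f (p z)) (f (q z)) ∂μ
      ≤ ∫⁻ z, (edist (f (p z)) (g (p z)) + edist (f (q z)) (g (q z))
        + (ε / 3 + ((M / d' : ℝ≥0) : ℝ≥0∞) * edist (p z) (q z))) ∂μ :=
        lintegral_mono fun z => key _ _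
    _ = ∫⁻ z, edist (f (p z)) (g (p z)) ∂μ + ∫⁻ z, edist (f (q z)) (g (q z)) ∂μ
        + (ε / 3 + ((M / d' : ℝ≥0) : ℝ≥0∞) * meanDist μ p q) := by
        rw [lintegral_add_left' (by exact hpm.add hqm), lintegral_add_left' hpm,
          lintegral_add_left measurable_const, lintegral_const_mul _ (hp.1.edist hq.1)]
        simp [meanDist]
    _ ≤ ε / 3 + ε / 3 + (ε / 3 + ((M / d' : ℝ≥0) : ℝ≥0∞) * meanDist μ p q) := by
        gcongr
        · exact hI hp
        · exact hI hq
    _ = ε + ((M / d' : ℝ≥0) : ℝ≥0∞) * meanDist μ p q := by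
        rw [← add_assoc, ENNReal.add_thirds]

lemma exists_meanDist_comp_le {f : I → I} (hf : Measurable f) {ε : ℝ≥0∞} (hε : ε ≠ 0) :
    ∃ C : ℝ≥0, ∀ {Z : Type} [MeasurableSpace Z] (μ : Measure Z) [IsProbabilityMeasure μ]
      (p q : Z → I), MeasurePreserving p μ volume → MeasurePreserving q μ volume →
      meanDist μ (f ∘ p) (f ∘ q) ≤ ε + C * meanDist μ p q := by
  have hint : Integrable (fun x => (f x : ℝ)) volume :=
    Integrable.of_bound (measurable_subtype_coe.comp hf).aestronglyMeasurable 1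
      (ae_of_all _ fun x => by
        rw [Real.norm_eq_abs, abs_of_nonneg (f x).2.1]; exact (f x).2.2)
  exact exists_lintegral_edist_comp_le hint hε

lemma exists_measure_symmDiff_preimage_le {A : Set I} (hA : MeasurableSet A) {ε : ℝ≥0∞}
    (hε : ε ≠ 0) :
    ∃ C : ℝ≥0, ∀ {Z : Type} [MeasurableSpace Z] (μ : Measure Z) [IsProbabilityMeasure μ]
      (p q : Z → I), MeasurePreserving p μ volume → MeasurePreserving q μ volume →
      μ ((p ⁻¹' A) ∆ (q ⁻¹' A)) ≤ ε + C * meanDist μ p q := by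
  have hint : Integrable (A.indicator (fun _ => (1 : ℝ))) volume :=
    (integrable_const 1).indicator hA
  obtain ⟨C, hC⟩ := exists_lintegral_edist_comp_le hint hε
  refine ⟨C, fun {Z} _ μ _ p q hp hq => ?_⟩
  refine le_trans (le_of_eq ?_) (hC μ p q hp hq)
  rw [← lintegral_indicator_one ((hp.1 hA).symmDiff (hq.1 hA))]
  refine lintegral_congr fun z => ?_
  by_cases h1 : p z ∈ A <;> by_cases h2 : q z ∈ A <;>
    simp [Set.mem_symmDiff, h1, h2, Set.indicator, edist_dist]

/-- A map between standard Borel spaces that is injective on a conull set agrees almost everywhere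
with a Borel isomorphism, provided both spaces carry an uncountable null set. -/
lemma exists_measurableEquiv_ae_eq {X Y : Type*} [MeasurableSpace X] [StandardBorelSpace X]
    [MeasurableSpace Y] [StandardBorelSpace Y] {μ : Measure X} {ν : Measure Y}
    {f : X → Y} (hf : MeasurePreserving f μ ν) {S : Set X} (hS : MeasurableSet S)
    (hSμ : μ Sᶜ = 0) (hinj : Set.InjOn f S)
    {C : Set X} (hC : MeasurableSet C) (hCμ : μ C = 0) (hCc : ¬ C.Countable)
    {D : Set Y} (hD : MeasurableSet D) (hDν : ν D = 0) (hDc : ¬ D.Countable) :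
    ∃ e : X ≃ᵐ Y, ⇑e =ᵐ[μ] f := by
  classical
  set S' : Set X := S \ (C ∪ f ⁻¹' D) with hS'
  have hS'm : MeasurableSet S' := hS.diff (hC.union (hf.1 hD))
  have := hS'm.standardBorel
  have hemb : MeasurableEmbedding (S'.domRestrict f) :=
    (hf.1.comp measurable_subtype_coe).measurableEmbedding
      (Set.injOn_iff_injective.1 (hinj.mono Set.sdiff_subset))
  set T : Set Y := S'.domRestrict f '' Set.univ with hT
  have hTm : MeasurableSet T := hemb.measurableSet_image' MeasurableSet.univ
  have := hS'm.compl.standardBorel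
  have := hTm.compl.standardBorel
  have hu1 : ¬ Countable (S'ᶜ : Set X) := fun h =>
    hCc (Set.Countable.mono (fun x hx => by simp [hS', hx]) (Set.countable_coe_iff.1 h))
  have hu2 : ¬ Countable (Tᶜ : Set Y) := fun h =>
    hDc (Set.Countable.mono (fun x hx => by
      rintro ⟨⟨y, hy⟩, -, rfl⟩
      exact hy.2 (Or.inr hx)) (Set.countable_coe_iff.1 h))
  let e1 : S' ≃ᵐ T :=
    (MeasurableEquiv.Set.univ _).symm.trans (hemb.equivImage Set.univ)
  let e2 : (S'ᶜ : Set X) ≃ᵐ (Tᶜ : Set Y) := PolishSpace.measurableEquivOfNotCountable hu1 hu2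
  refine ⟨(MeasurableEquiv.sumCompl hS'm).symm.trans
    ((MeasurableEquiv.sumCongr e1 e2).trans (MeasurableEquiv.sumCompl hTm)), ?_⟩
  have h0 : μ S'ᶜ = 0 := by
    refine measure_mono_null (t := Sᶜ ∪ (C ∪ f ⁻¹' D)) ?_ ?_
    · intro x hx
      by_contra h
      exact hx ⟨by_contra fun h' => h (Or.inl h'), fun h' => h (Or.inr h')⟩
    · refine measure_union_null hSμ (measure_union_null hCμ ?_)
      rw [hf.measure_preimage hD.nullMeasurableSet, hDν]
  filter_upwards [compl_mem_ae_iff.2 h0] with x hx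
  have hx' : x ∈ S' := by simpa using hx
  have : (MeasurableEquiv.sumCompl hS'm).symm x = Sum.inl ⟨x, hx'⟩ :=
    Equiv.sumCompl_symm_apply_of_pos hx'
  simp only [MeasurableEquiv.trans_apply, this]
  rfl

lemma exists_uncountable_null :
    ∃ D : Set I, MeasurableSet D ∧ (volume : Measure I) D = 0 ∧ ¬ D.Countable := by
  set L : Set ℝ := {x | Liouville x}
  obtain ⟨L', hLL', hL'm, hL'0⟩ := exists_measurable_superset_of_null volume_setOfPred_liouville
  refine ⟨Subtype.val ⁻¹' L', measurable_subtype_coe hL'm, ?_, fun hc => ?_⟩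
  · rw [unitInterval.volume_apply]
    exact measure_mono_null (Set.image_preimage_subset _ _) hL'0
  · have hc' : (L ∩ Set.Icc 0 1).Countable := by
      refine (hc.image Subtype.val).mono ?_
      rintro x ⟨hx, hx1⟩
      exact ⟨⟨x, hx1⟩, hLL' hx, rfl⟩
    have hres : (L ∩ Set.Icc 0 1)ᶜ ∈ residual ℝ := by
      have : (L ∩ Set.Icc 0 1)ᶜ = ⋂ x ∈ L ∩ Set.Icc 0 1, {x}ᶜ := by
        ext y; simp [not_and]; grind
      rw [this]
      refine (countable_bInter_mem hc').2 fun x _ => ?_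
      exact residual_of_dense_open isOpen_compl_singleton (dense_compl_singleton x)
    have hd := dense_of_mem_residual (Filter.inter_mem hres eventually_residual_liouville)
    obtain ⟨x, hx, hx'⟩ := hd.exists_mem_open isOpen_Ioo (Set.nonempty_Ioo.2 (zero_lt_one' ℝ))
    exact hx.1 ⟨hx.2, Set.Ioo_subset_Icc_self hx'⟩

lemma continuous_cdf (ρ : Measure ℝ) [IsProbabilityMeasure ρ] [NullSingletonClass ρ] :
    Continuous (cdf ρ) := by
  refine continuous_iff_continuousAt.2 fun x => ?_
  rw [(monotone_cdf ρ).continuousAt_iff_leftLim_eq_rightLim, StieltjesFunction.rightLim_eq]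
  have h : (cdf ρ).measure {x} = 0 := by rw [measure_cdf]; exact measure_singleton x
  rw [StieltjesFunction.measure_singleton, ENNReal.ofReal_eq_zero] at h
  exact le_antisymm ((monotone_cdf ρ).leftLim_le le_rfl) (by linarith)

/-- The probability integral transform. -/
lemma measure_cdf_le (ρ : Measure ℝ) [IsProbabilityMeasure ρ] [NullSingletonClass ρ] {c : ℝ}
    (hc : c ∈ Set.Icc (0 : ℝ) 1) : ρ {t | cdf ρ t ≤ c} = ENNReal.ofReal c := by
  rcases hc.2.eq_or_lt with rfl | hc1
  · simp [cdf_le_one]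
  set S : Set ℝ := {t | cdf ρ t ≤ c} with hS
  rcases S.eq_empty_or_nonempty with h | h
  · have hc0 : c = 0 := by
      by_contra hne
      have hpos : 0 < c := lt_of_le_of_ne hc.1 (Ne.symm hne)
      obtain ⟨t, ht⟩ := ((tendsto_cdf_atBot ρ).eventually (gt_mem_nhds hpos)).exists
      exact (h ▸ (show t ∈ S from ht.le) : t ∈ (∅ : Set ℝ))
    simp [h, hc0]
  · obtain ⟨b, hb⟩ := ((tendsto_cdf_atTop ρ).eventually (lt_mem_nhds hc1)).exists
    have hbdd : BddAbove S := ⟨b, fun t ht => by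
      by_contra hlt
      exact absurd ((monotone_cdf ρ (not_le.1 hlt).le).trans ht) (not_le.2 hb)⟩
    have hcl : IsClosed S := isClosed_le (continuous_cdf ρ) continuous_const
    have hmem : sSup S ∈ S := hcl.csSup_mem h hbdd
    have hIic : S = Set.Iic (sSup S) := by
      ext t
      exact ⟨fun ht => le_csSup hbdd ht, fun ht => (monotone_cdf ρ ht).trans hmem⟩
    have heq : cdf ρ (sSup S) = c := by
      refine le_antisymm hmem (not_lt.1 fun hlt => ?_)
      have hev : ∀ᶠ s in 𝓝[>] (sSup S), cdf ρ s < c :=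
        ((continuous_cdf ρ).continuousAt.tendsto.mono_left nhdsWithin_le_nhds).eventually
          (gt_mem_nhds hlt)
      obtain ⟨s, hs, hs'⟩ := (hev.and self_mem_nhdsWithin).exists
      exact absurd (le_csSup hbdd (show s ∈ S from hs.le)) (not_le.2 hs')
    rw [hIic, ← ofReal_cdf, heq]

/-- An atomless standard Borel probability space is isomorphic to the unit interval, by an
isomorphism arbitrarily close to any given measure preserving map. -/
lemma exists_measurableEquiv_near {Z : Type*} [MeasurableSpace Z] [StandardBorelSpace Z]
    {ν : Measure Z} [IsProbabilityMeasure ν] [NullSingletonClass ν]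
    {C : Set Z} (hC : MeasurableSet C) (hCν : ν C = 0) (hCc : ¬ C.Countable)
    {φ : Z → I} (hφ : MeasurePreserving φ ν volume) {η : ℝ≥0∞} (hη : η ≠ 0) :
    ∃ e : Z ≃ᵐ I, MeasurePreserving e ν volume ∧ meanDist ν e φ ≤ η := by
  have hZ : ¬ Countable Z := fun h => hCc (Set.to_countable C)
  obtain ⟨D, hD, hD0, hDc⟩ := exists_uncountable_null
  have hI : ¬ Countable I := fun h => hDc (Set.to_countable D)
  let e0 : Z ≃ᵐ I := PolishSpace.measurableEquivOfNotCountable hZ hI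
  obtain ⟨K, hK⟩ : ∃ K : ℕ, (K + 1 : ℝ≥0∞)⁻¹ < η := by
    obtain ⟨n, hn⟩ := ENNReal.exists_inv_nat_lt hη
    exact ⟨n, lt_of_le_of_lt (ENNReal.inv_le_inv.2 le_self_add) hn⟩
  have hK0 : (0 : ℝ) < K + 1 := by positivity
  let a : Z → ℤ := fun z => ⌊(K + 1 : ℝ) * φ z⌋
  let g : Z → ℝ := fun z => a z + (e0 z : ℝ) / 2
  have ham : Measurable a :=
    Int.measurable_floor.comp ((measurable_subtype_coe.comp hφ.1).const_mul _)
  have hgm : Measurable g :=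
    (measurable_from_top.comp ham).add ((measurable_subtype_coe.comp e0.measurable).div_const _)
  have hga : ∀ z, ⌊g z⌋ = a z := by
    intro z
    rw [Int.floor_eq_iff]
    have := (e0 z).2
    constructor <;> simp only [g] <;> linarith [this.1, this.2]
  have hginj : Function.Injective g := by
    intro z w h
    have h1 : a z = a w := by rw [← hga, ← hga, h]
    have h2 : (e0 z : ℝ) = e0 w := by
      simp only [g, h1] at h; linarith
    exact e0.injective (Subtype.ext h2)
  set ρ : Measure ℝ := ν.map g with hρ
  have : IsProbabilityMeasure ρ := Measure.isProbabilityMeasure_map hgm.aemeasurable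
  have : NullSingletonClass ρ := ⟨fun x => by
    rw [hρ, Measure.map_apply hgm (measurableSet_singleton x)]
    exact (Set.subsingleton_singleton.preimage hginj).measure_zero _⟩
  let F : ℝ → I := fun t => ⟨cdf ρ t, cdf_nonneg ρ t, cdf_le_one ρ t⟩
  have hFm : Measurable F := (monotone_cdf ρ).measurable.subtype_mk
  have hFρ : MeasurePreserving F ρ volume := by
    refine ⟨hFm, ?_⟩
    have : IsProbabilityMeasure (ρ.map F) := Measure.isProbabilityMeasure_map hFm.aemeasurable
    refine Measure.ext_of_Iic _ _ fun c => ?_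
    rw [Measure.map_apply hFm measurableSet_Iic, unitInterval.volume_Iic]
    exact measure_cdf_le ρ c.2
  have hgρ : MeasurePreserving g ν ρ := ⟨hgm, rfl⟩
  have hψ : MeasurePreserving (F ∘ g) ν volume := hFρ.comp hgρ
  let B : Set ℝ := ⋃ q : ℚ, F ⁻¹' {F q}
  have hBm : MeasurableSet B := MeasurableSet.iUnion fun q => hFm (measurableSet_singleton _)
  have hB0 : ρ B = 0 := measure_iUnion_null fun q => by
    rw [hFρ.measure_preimage (measurableSet_singleton _).nullMeasurableSet]
    exact measure_singleton _
  have hmono : Monotone F := fun s t h => monotone_cdf ρ h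
  have hFinj : Set.InjOn F Bᶜ := by
    have aux : ∀ s ∈ Bᶜ, ∀ t, s < t → F s ≠ F t := by
      intro s hs t hst h
      obtain ⟨q, hq1, hq2⟩ := exists_rat_btwn hst
      refine hs (Set.mem_iUnion.2 ⟨q, le_antisymm (hmono hq1.le) ?_⟩)
      rw [h]; exact hmono hq2.le
    intro s hs t ht h
    rcases lt_trichotomy s t with h' | h' | h'
    · exact absurd h (aux s hs t h')
    · exact h'
    · exact absurd h.symm (aux t ht s h')
  obtain ⟨e, he⟩ := exists_measurableEquiv_ae_eq hψ (S := g ⁻¹' Bᶜ) (hgm hBm.compl)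
    (by rw [← Set.preimage_compl, compl_compl, hgρ.measure_preimage hBm.nullMeasurableSet, hB0])
    (fun z hz w hw h => hginj (hFinj hz hw h)) hC hCν hCc hD hD0 hDc
  refine ⟨e, ⟨e.measurable, by rw [Measure.map_congr he, hψ.map_eq]⟩, ?_⟩
  rw [meanDist_congr he (EventuallyEq.refl _ φ)]
  refine (meanDist_le_of_edist_le (ae_of_all _ fun z => ?_)).trans hK.le
  have hz := (φ z).2
  have hf1 : (a z : ℝ) ≤ (K + 1) * φ z := Int.floor_le _
  have hf2 : (K + 1) * (φ z : ℝ) < a z + 1 := Int.lt_floor_add_one _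
  have hcdf : cdf ρ (g z) = ν.real {w | g w ≤ g z} := by
    rw [cdf_eq_real, measureReal_def, hρ, Measure.map_apply hgm measurableSet_Iic]; rfl
  have hlow : (a z : ℝ) / (K + 1) ≤ cdf ρ (g z) := by
    have h1 : (a z : ℝ) / (K + 1) ∈ Set.Icc (0 : ℝ) 1 := by
      refine ⟨div_nonneg (Int.cast_nonneg (Int.floor_nonneg.2 (mul_nonneg hK0.le hz.1))) hK0.le, ?_⟩
      rw [div_le_one hK0]; nlinarith [hz.2]
    have h2 : ν (φ ⁻¹' Set.Iio ⟨_, h1⟩) = ENNReal.ofReal ((a z : ℝ) / (K + 1)) := by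
      rw [hφ.measure_preimage measurableSet_Iio.nullMeasurableSet, unitInterval.volume_Iio]
    rw [hcdf, ← ENNReal.toReal_ofReal h1.1, ← h2]
    refine measureReal_mono (fun w hw => ?_)
    have hw' : (φ w : ℝ) < (a z : ℝ) / (K + 1) := hw
    rw [lt_div_iff₀' hK0] at hw'
    have : a w < a z := Int.floor_lt.2 hw'
    have h3 : (a w : ℝ) + 1 ≤ a z := by exact_mod_cast this
    simp only [Set.mem_ofPred_eq, g]
    linarith [(e0 w).2.2, (e0 z).2.1]
  have hup : cdf ρ (g z) ≤ ((a z : ℝ) + 1) / (K + 1) := by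
    by_cases h1 : ((a z : ℝ) + 1) / (K + 1) ∈ Set.Icc (0 : ℝ) 1
    · have h2 : ν (φ ⁻¹' Set.Iio ⟨_, h1⟩) = ENNReal.ofReal (((a z : ℝ) + 1) / (K + 1)) := by
        rw [hφ.measure_preimage measurableSet_Iio.nullMeasurableSet, unitInterval.volume_Iio]
      rw [hcdf, ← ENNReal.toReal_ofReal h1.1, ← h2]
      refine measureReal_mono (fun w hw => ?_)
      have hw' : g w ≤ g z := hw
      have h3 : a w ≤ a z := by rw [← hga, ← hga]; exact Int.floor_le_floor hw'
      have h4 : (a w : ℝ) ≤ a z := by exact_mod_cast h3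
      have h5 : (K + 1) * (φ w : ℝ) < a w + 1 := Int.lt_floor_add_one _
      show (φ w : ℝ) < _
      rw [lt_div_iff₀' hK0]
      linarith
    · refine (cdf_le_one ρ _).trans (not_lt.1 fun hlt => h1 ⟨?_, hlt.le⟩)
      have : (0 : ℝ) ≤ a z := Int.cast_nonneg (Int.floor_nonneg.2 (mul_nonneg hK0.le hz.1))
      positivity
  have hφ1 : (a z : ℝ) / (K + 1) ≤ φ z := by rw [div_le_iff₀' hK0]; exact hf1
  have hφ2 : (φ z : ℝ) ≤ ((a z : ℝ) + 1) / (K + 1) := by rw [le_div_iff₀' hK0]; exact hf2.le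
  rw [add_div] at hup hφ2
  have hd : dist ((F ∘ g) z) (φ z) ≤ 1 / (K + 1) := by
    rw [Subtype.dist_eq, Real.dist_eq, abs_le]
    constructor <;> simp only [F, Function.comp] <;> linarith
  rw [edist_dist]
  refine (ENNReal.ofReal_le_ofReal hd).trans (le_of_eq ?_)
  rw [one_div, ENNReal.ofReal_inv_of_pos hK0, ENNReal.ofReal_add (by positivity) zero_le_one]
  simp

lemma tendsto_zero_of_le_add_mul {ι : Type*} {l : Filter ι} {u v : ι → ℝ≥0∞}
    (h : ∀ ε : ℝ≥0∞, ε ≠ 0 → ∃ C : ℝ≥0, ∀ i, u i ≤ ε + C * v i) (hv : Tendsto v l (𝓝 0)) :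
    Tendsto u l (𝓝 0) := by
  refine ENNReal.tendsto_nhds_zero.2 fun ε hε => ?_
  obtain ⟨C, hC⟩ := h (ε / 2) (by simpa using hε.ne')
  have hCv : Tendsto (fun i => (C : ℝ≥0∞) * v i) l (𝓝 0) := by
    simpa using ENNReal.Tendsto.const_mul hv (Or.inr ENNReal.coe_ne_top)
  filter_upwards [ENNReal.tendsto_nhds_zero.1 hCv (ε / 2) (ENNReal.half_pos hε.ne')] with i hi
  calc u i ≤ ε / 2 + C * v i := hC i
    _ ≤ ε / 2 + ε / 2 := by gcongr
    _ = ε := ENNReal.add_halves ε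

/-- The inverse transformation. -/
def symm (T : Aut01) : Aut01 :=
  ⟨T.toEquiv.symm, T.measurePreserving_invFun, T.measurePreserving_toFun⟩

lemma measurable_coe (T : Aut01) : Measurable T.toEquiv := T.measurePreserving_toFun.1

lemma exists_meanDist_symm_le (S : Aut01) {ε : ℝ≥0∞} (hε : ε ≠ 0) :
    ∃ C : ℝ≥0, ∀ T : Aut01, meanDist volume S.toEquiv.symm T.toEquiv.symm ≤
      ε + C * meanDist volume S.toEquiv T.toEquiv := by
  obtain ⟨C, hC⟩ := exists_meanDist_comp_le S.symm.measurable_coe hε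
  refine ⟨C, fun T => ?_⟩
  have h := hC volume _ _ T.measurePreserving_toFun S.measurePreserving_toFun
  rw [meanDist_comm (p := (T.toEquiv : I → I))] at h
  refine le_trans (le_of_eq ?_) h
  change meanDist volume S.symm.toEquiv T.symm.toEquiv = _
  rw [← meanDist_comp T.measurePreserving_toFun S.symm.measurable_coe T.symm.measurable_coe]
  have h1 : (T.symm.toEquiv : I → I) ∘ T.toEquiv = S.symm.toEquiv ∘ S.toEquiv := by
    ext x; simp [symm]
  rw [h1]

/-- A metric for the weak topology: the sum of the `L¹` distances between two transformations and
between their inverses. -/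
def autDist (S T : Aut01) : ℝ≥0∞ :=
  meanDist volume S.toEquiv T.toEquiv + meanDist volume S.toEquiv.symm T.toEquiv.symm

lemma autDist_ne_top (S T : Aut01) : autDist S T ≠ ∞ :=
  ENNReal.add_ne_top.2 ⟨(meanDist_le_one.trans_lt ENNReal.one_lt_top).ne,
    (meanDist_le_one.trans_lt ENNReal.one_lt_top).ne⟩

lemma autDist_triangle (S T R : Aut01) : autDist S R ≤ autDist S T + autDist T R := by
  refine (add_le_add (meanDist_triangle S.measurable_coe T.measurable_coe)
    (meanDist_triangle S.symm.measurable_coe T.symm.measurable_coe)).trans (le_of_eq ?_)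
  simp only [autDist, symm]
  ring

lemma tendsto_autDist_iff {ι : Type*} {l : Filter ι} {u : ι → Aut01} {S : Aut01} :
    Tendsto (fun i => autDist S (u i)) l (𝓝 0) ↔
      Tendsto (fun i => meanDist volume S.toEquiv (u i).toEquiv) l (𝓝 0) := by
  constructor
  · exact fun h => tendsto_of_tendsto_of_tendsto_of_le_of_le tendsto_const_nhds h
      (fun _ => zero_le) (fun _ => le_self_add)
  · intro h
    have h' : Tendsto (fun i => meanDist volume S.toEquiv.symm (u i).toEquiv.symm) l (𝓝 0) :=
      tendsto_zero_of_le_add_mul (fun ε hε => by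
        obtain ⟨C, hC⟩ := S.exists_meanDist_symm_le hε
        exact ⟨C, fun i => hC (u i)⟩) h
    simpa [autDist] using h.add h'

lemma tendsto_autDist_symm_iff {ι : Type*} {l : Filter ι} {u : ι → Aut01} {S : Aut01} :
    Tendsto (fun i => autDist S (u i)) l (𝓝 0) ↔
      Tendsto (fun i => meanDist volume S.toEquiv.symm (u i).toEquiv.symm) l (𝓝 0) := by
  have h := tendsto_autDist_iff (l := l) (u := fun i => (u i).symm) (S := S.symm)
  have h' : ∀ T, autDist S.symm T.symm = autDist S T := fun T => add_comm _ _
  simp only [h'] at h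
  exact h

lemma measurableSet_dyadic (ℓ k : ℕ) : MeasurableSet (dyadic ℓ k) :=
  (measurableSet_le measurable_const measurable_subtype_coe).inter
    (measurableSet_lt measurable_subtype_coe measurable_const)

/-- The summand of rank `ℓ + 1` in `wDist`, without its weight. -/
def rankDist (T S : Aut01) (ℓ : ℕ) : ℝ :=
  ∑ k ∈ Finset.range (2 ^ (ℓ + 1)),
    (volume (symmDiff (T.toEquiv '' dyadic (ℓ + 1) k) (S.toEquiv '' dyadic (ℓ + 1) k))).toReal

lemma rankDist_nonneg (T S : Aut01) (ℓ : ℕ) : 0 ≤ rankDist T S ℓ :=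
  Finset.sum_nonneg fun _ _ => ENNReal.toReal_nonneg

lemma wDist_term_nonneg (T S : Aut01) (ℓ : ℕ) :
    0 ≤ (1 / 2 ^ (2 * (ℓ + 1)) : ℝ) * rankDist T S ℓ :=
  mul_nonneg (by positivity) (rankDist_nonneg T S ℓ)

lemma wDist_term_le (T S : Aut01) (ℓ : ℕ) :
    (1 / 2 ^ (2 * (ℓ + 1)) : ℝ) * rankDist T S ℓ ≤ (1 / 2) ^ (ℓ + 1) := by
  have h : rankDist T S ℓ ≤ 2 ^ (ℓ + 1) := by
    refine (Finset.sum_le_card_nsmul _ _ 1 fun k _ => ?_).trans (by simp)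
    exact ENNReal.toReal_le_of_le_ofReal zero_le_one (by simpa using prob_le_one)
  calc (1 / 2 ^ (2 * (ℓ + 1)) : ℝ) * rankDist T S ℓ
      ≤ (1 / 2 ^ (2 * (ℓ + 1)) : ℝ) * 2 ^ (ℓ + 1) := by gcongr
    _ = (1 / 2) ^ (ℓ + 1) := by
        rw [two_mul, pow_add, one_div_pow]; field_simp

lemma summable_half_pow_succ : Summable fun ℓ : ℕ => (1 / 2 : ℝ) ^ (ℓ + 1) :=
  (summable_nat_add_iff 1).2 summable_geometric_two

lemma summable_wDist (T S : Aut01) :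
    Summable fun ℓ : ℕ => (1 / 2 ^ (2 * (ℓ + 1)) : ℝ) * rankDist T S ℓ :=
  Summable.of_nonneg_of_le (wDist_term_nonneg T S) (wDist_term_le T S) summable_half_pow_succ

lemma wDist_nonneg (T S : Aut01) : 0 ≤ wDist T S := tsum_nonneg (wDist_term_nonneg T S)

lemma wDist_self (T : Aut01) : wDist T T = 0 := by simp [wDist]

lemma wDist_triangle (T S R : Aut01) : wDist T R ≤ wDist T S + wDist S R := by
  change ∑' ℓ : ℕ, _ * rankDist T R ℓ ≤
    ∑' ℓ : ℕ, _ * rankDist T S ℓ + ∑' ℓ : ℕ, _ * rankDist S R ℓ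
  rw [← (summable_wDist T S).tsum_add (summable_wDist S R)]
  refine (summable_wDist T R).tsum_le_tsum (fun ℓ => ?_)
    ((summable_wDist T S).add (summable_wDist S R))
  rw [← mul_add, rankDist, rankDist, rankDist, ← Finset.sum_add_distrib]
  gcongr with k
  rw [← ENNReal.toReal_add (by simp) (by simp)]
  exact ENNReal.toReal_mono (by simp) (measure_symmDiff_le _ _ _)

lemma tendsto_wDist {ι : Type*} {l : Filter ι} {u : ι → Aut01} {S : Aut01}
    (h : Tendsto (fun i => autDist S (u i)) l (𝓝 0)) :
    Tendsto (fun i => wDist S (u i)) l (𝓝 0) := by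
  have hs := tendsto_autDist_symm_iff.1 h
  have hk : ∀ ℓ k : ℕ, Tendsto (fun i => (volume (symmDiff (S.toEquiv '' dyadic (ℓ + 1) k)
      ((u i).toEquiv '' dyadic (ℓ + 1) k))).toReal) l (𝓝 0) := by
    intro ℓ k
    have : Tendsto (fun i => volume (symmDiff (S.toEquiv '' dyadic (ℓ + 1) k)
      ((u i).toEquiv '' dyadic (ℓ + 1) k))) l (𝓝 0) := by
      refine tendsto_zero_of_le_add_mul (fun ε hε => ?_) hs
      obtain ⟨C, hC⟩ := exists_measure_symmDiff_preimage_le (measurableSet_dyadic (ℓ + 1) k) hε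
      refine ⟨C, fun i => ?_⟩
      rw [Equiv.image_eq_preimage_symm, Equiv.image_eq_preimage_symm]
      exact hC volume _ _ S.measurePreserving_invFun (u i).measurePreserving_invFun
    exact ENNReal.toReal_zero ▸ (ENNReal.tendsto_toReal ENNReal.zero_ne_top).comp this
  have ht := tendsto_tsum_of_dominated_convergence
    (f := fun i ℓ => (1 / 2 ^ (2 * (ℓ + 1)) : ℝ) * rankDist S (u i) ℓ) (g := fun _ => 0)
    (𝓕 := l) summable_half_pow_succ (fun ℓ => ?_) (.of_forall fun i ℓ => ?_)
  · rw [tsum_zero] at ht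
    exact ht
  · have : Tendsto (fun i => rankDist S (u i) ℓ) l (𝓝 0) := by
      have h := tendsto_finsetSum (Finset.range (2 ^ (ℓ + 1))) fun k _ => hk ℓ k
      rw [Finset.sum_const_zero] at h
      exact h
    simpa using this.const_mul (1 / 2 ^ (2 * (ℓ + 1)) : ℝ)
  · rw [Real.norm_of_nonneg (wDist_term_nonneg _ _ _)]
    exact wDist_term_le _ _ _

lemma exists_mem_dyadic (ℓ : ℕ) {u : I} (hu : u ≠ 1) :
    ∃ k ∈ Finset.range (2 ^ ℓ), u ∈ dyadic ℓ k := by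
  have hu1 : (u : ℝ) < 1 := lt_of_le_of_ne u.2.2 fun h => hu (Subtype.ext h)
  have h2 : (0 : ℝ) < 2 ^ ℓ := by positivity
  have h0 : 0 ≤ (2 : ℝ) ^ ℓ * u := mul_nonneg h2.le u.2.1
  refine ⟨⌊(2 : ℝ) ^ ℓ * u⌋₊, ?_, ?_, ?_⟩
  · rw [Finset.mem_range, Nat.floor_lt h0]
    push_cast
    nlinarith
  · rw [div_le_iff₀' h2]
    exact Nat.floor_le h0
  · rw [lt_div_iff₀' h2]
    exact Nat.lt_floor_add_one _

lemma meanDist_symm_le_wDist (S T : Aut01) (ℓ : ℕ) :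
    meanDist volume S.toEquiv.symm T.toEquiv.symm ≤
      ENNReal.ofReal (1 / 2 ^ (ℓ + 1)) +
        (2 ^ (2 * (ℓ + 1)) : ℝ≥0) * ENNReal.ofReal (wDist S T) := by
  set N : Set I := ⋃ k ∈ Finset.range (2 ^ (ℓ + 1)),
    symmDiff (S.toEquiv '' dyadic (ℓ + 1) k) (T.toEquiv '' dyadic (ℓ + 1) k) with hN
  have hNm : MeasurableSet N := by
    refine Finset.measurableSet_biUnion _ fun k _ => ?_
    rw [Equiv.image_eq_preimage_symm, Equiv.image_eq_preimage_symm]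
    exact (S.symm.measurable_coe (measurableSet_dyadic _ _)).symmDiff
      (T.symm.measurable_coe (measurableSet_dyadic _ _))
  have hNμ : volume N ≤ (2 ^ (2 * (ℓ + 1)) : ℝ≥0) * ENNReal.ofReal (wDist S T) := by
    calc volume N ≤ ∑ k ∈ Finset.range (2 ^ (ℓ + 1)), volume
          (symmDiff (S.toEquiv '' dyadic (ℓ + 1) k) (T.toEquiv '' dyadic (ℓ + 1) k)) :=
          measure_biUnion_finset_le _ _
      _ = ENNReal.ofReal (rankDist S T ℓ) := by
          rw [rankDist, ENNReal.ofReal_sum_of_nonneg fun _ _ => ENNReal.toReal_nonneg]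
          exact Finset.sum_congr rfl fun k _ => (ENNReal.ofReal_toReal (by simp)).symm
      _ ≤ ENNReal.ofReal (2 ^ (2 * (ℓ + 1)) * wDist S T) := by
          refine ENNReal.ofReal_le_ofReal ?_
          have h : (1 / 2 ^ (2 * (ℓ + 1)) : ℝ) * rankDist S T ℓ ≤ wDist S T :=
            (summable_wDist S T).le_tsum ℓ fun j _ => wDist_term_nonneg S T j
          rw [one_div, inv_mul_le_iff₀ (by positivity)] at h
          exact h
      _ = _ := by
          rw [ENNReal.ofReal_mul (by positivity)]
          congr 1
          rw [← ENNReal.ofReal_coe_nnreal]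
          simp
  refine (meanDist_le_add_measure hNm (c := ENNReal.ofReal (1 / 2 ^ (ℓ + 1))) ?_).trans
    (by gcongr)
  have hne : ∀ᵐ x : I, x ≠ S.toEquiv 1 := measure_eq_zero_iff_ae_notMem.1 (measure_singleton _)
  filter_upwards [hne] with x hx hxN
  obtain ⟨k, hk, hxk⟩ := exists_mem_dyadic (ℓ + 1) (u := S.toEquiv.symm x)
    (fun h => hx (by rw [← h, Equiv.apply_symm_apply]))
  have hxk' : T.toEquiv.symm x ∈ dyadic (ℓ + 1) k := by
    by_contra h
    refine hxN (Set.mem_biUnion hk (Or.inl ⟨⟨_, hxk, by simp⟩, ?_⟩))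
    rw [Equiv.image_eq_preimage_symm]
    exact h
  rw [edist_dist]
  refine ENNReal.ofReal_le_ofReal ?_
  obtain ⟨h1, h2⟩ := hxk
  obtain ⟨h3, h4⟩ := hxk'
  rw [add_div] at h2 h4
  rw [Subtype.dist_eq, Real.dist_eq, abs_le]
  constructor <;> linarith

lemma comap_wDist_le (S : Aut01) :
    comap (wDist S) (𝓝 0) ≤ comap (autDist S) (𝓝 0) := by
  rw [← tendsto_iff_comap]
  refine (tendsto_autDist_symm_iff (u := id)).2 ?_
  have h : Tendsto (fun T => ENNReal.ofReal (wDist S T)) (comap (wDist S) (𝓝 0)) (𝓝 0) := by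
    simpa using ENNReal.tendsto_ofReal (tendsto_comap (f := wDist S) (x := 𝓝 0))
  refine tendsto_zero_of_le_add_mul (fun ε hε => ?_) h
  obtain ⟨n, hn⟩ : ∃ n : ℕ, ENNReal.ofReal (1 / 2 ^ (n + 1)) ≤ ε := by
    have hp : Tendsto (fun n : ℕ => ENNReal.ofReal (1 / 2 ^ (n + 1))) atTop (𝓝 0) := by
      have := ENNReal.tendsto_ofReal summable_half_pow_succ.tendsto_atTop_zero
      simpa using this
    exact (ENNReal.tendsto_nhds_zero.1 hp ε (pos_iff_ne_zero.2 hε)).exists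
  exact ⟨_, fun T => (meanDist_symm_le_wDist S T n).trans (by gcongr)⟩

lemma isOpen_iff_comap {s : Set Aut01} :
    IsOpen s ↔ ∀ S ∈ s, s ∈ comap (autDist S) (𝓝 0) := by
  constructor
  · intro h
    induction h with
    | basic s hs =>
      obtain ⟨T, ε, hε, rfl⟩ := hs
      intro S hS
      have hS' : wDist T S < ε := hS
      have ht : Tendsto (wDist S) (comap (autDist S) (𝓝 0)) (𝓝 0) :=
        tendsto_wDist (u := id) tendsto_comap
      filter_upwards [ht.eventually (gt_mem_nhds (sub_pos.2 hS'))] with R hR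
      show wDist T R < ε
      linarith [wDist_triangle T S R]
    | univ => exact fun _ _ => univ_mem
    | inter s t _ _ hs ht => exact fun S hS => inter_mem (hs S hS.1) (ht S hS.2)
    | sUnion c _ hc =>
      rintro S ⟨t, ht, hSt⟩
      exact mem_of_superset (hc t ht S hSt) (Set.subset_sUnion_of_mem ht)
  · intro h
    refine isOpen_iff_mem_nhds.2 fun S hS => ?_
    obtain ⟨ε, hε, hs⟩ := (Metric.nhds_basis_ball.comap (wDist S)).mem_iff.1
      (comap_wDist_le S (h S hS))
    refine mem_nhds_iff.2 ⟨{T | wDist S T < ε}, fun T hT => hs ?_, ?_, ?_⟩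
    · simpa [abs_of_nonneg (wDist_nonneg S T)] using hT
    · exact TopologicalSpace.isOpen_generateFrom_of_mem ⟨S, ε, hε, rfl⟩
    · show wDist S S < ε
      rwa [wDist_self]

lemma nhds_eq_comap (S : Aut01) : 𝓝 S = comap (autDist S) (𝓝 0) := by
  have hb : (comap (autDist S) (𝓝 0)).HasBasis (fun ε : ℝ≥0∞ => 0 < ε)
      (fun ε => {T | autDist S T < ε}) := ENNReal.nhds_zero_basis.comap _
  refine le_antisymm ?_ fun s hs => ?_
  · refine hb.ge_iff.2 fun ε hε => IsOpen.mem_nhds (isOpen_iff_comap.2 fun T hT => ?_) ?_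
    · have hT' : autDist S T < ε := hT
      have hev : ∀ᶠ R in comap (autDist T) (𝓝 0), autDist T R < ε - autDist S T :=
        tendsto_comap.eventually (gt_mem_nhds (tsub_pos_of_lt hT'))
      filter_upwards [hev] with R hR
      calc autDist S R ≤ autDist S T + autDist T R := autDist_triangle S T R
        _ < autDist S T + (ε - autDist S T) :=
          ENNReal.add_lt_add_left (autDist_ne_top S T) hR
        _ = ε := add_tsub_cancel_of_le hT'.le
    · show autDist S S < ε
      simpa [autDist, meanDist_self] using hε
  · obtain ⟨t, hts, ht, hSt⟩ := mem_nhds_iff.1 hs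
    exact mem_of_superset (isOpen_iff_comap.1 ht S hSt) hts

lemma tendsto_nhds_iff {ι : Type*} {l : Filter ι} {u : ι → Aut01} {S : Aut01} :
    Tendsto u l (𝓝 S) ↔
      Tendsto (fun i => meanDist volume S.toEquiv (u i).toEquiv) l (𝓝 0) := by
  rw [nhds_eq_comap, tendsto_comap_iff, ← tendsto_autDist_iff]
  rfl

lemma measurePreserving_of_tendsto {p : ℕ → I → I} {g : I → I}
    (hp : ∀ n, MeasurePreserving (p n) volume volume) (hg : Measurable g)
    (h : ∀ᵐ x, Tendsto (fun n => p n x) atTop (𝓝 (g x))) :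
    MeasurePreserving g volume volume := by
  refine ⟨hg, ?_⟩
  have : IsProbabilityMeasure (volume.map g) := Measure.isProbabilityMeasure_map hg.aemeasurable
  refine ext_of_forall_integral_eq_of_IsFiniteMeasure fun f => ?_
  rw [integral_map hg.aemeasurable f.continuous.aestronglyMeasurable]
  have h1 : Tendsto (fun n => ∫ x, f (p n x)) atTop (𝓝 (∫ x, f (g x))) := by
    refine tendsto_integral_of_dominated_convergence (fun _ => ‖f‖)
      (fun n => (f.continuous.measurable.comp (hp n).1).aestronglyMeasurable)
      (integrable_const _) (fun n => ae_of_all _ fun x => f.norm_coe_le_norm _) ?_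
    filter_upwards [h] with x hx
    exact (f.continuous.tendsto _).comp hx
  have h2 : ∀ n, ∫ x, f (p n x) = ∫ x, f x := fun n => by
    rw [← integral_map (hp n).aemeasurable f.continuous.aestronglyMeasurable, (hp n).map_eq]
  simp only [h2] at h1
  exact tendsto_nhds_unique h1 tendsto_const_nhds

/-- Measure preserving maps that are summably Cauchy in mean converge in mean. -/
lemma exists_meanDist_limit {p : ℕ → I → I} (hp : ∀ n, MeasurePreserving (p n) volume volume)
    (h : ∑' n, meanDist volume (p n) (p (n + 1)) ≠ ∞) :
    ∃ g : I → I, MeasurePreserving g volume volume ∧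
      Tendsto (fun n => meanDist volume (p n) g) atTop (𝓝 0) := by
  have hm : ∀ n, Measurable fun x => edist (p n x) (p (n + 1) x) :=
    fun n => (hp n).1.edist (hp (n + 1)).1
  have hsum : ∫⁻ x, ∑' n, edist (p n x) (p (n + 1) x) ≠ ∞ := by
    rw [lintegral_tsum fun n => (hm n).aemeasurable]
    exact h
  have hlim : ∀ᵐ x, ∃ l, Tendsto (fun n => p n x) atTop (𝓝 l) := by
    filter_upwards [ae_lt_top (Measurable.tsum hm) hsum] with x hx
    exact cauchySeq_tendsto_of_complete
      (cauchySeq_of_edist_le_of_tsum_ne_top _ (fun n => le_rfl) hx.ne)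
  obtain ⟨g, hg, hpg⟩ :=
    measurable_limit_of_tendsto_metrizable_ae (fun n => (hp n).1.aemeasurable) hlim
  refine ⟨g, measurePreserving_of_tendsto hp hg hpg, ?_⟩
  have ht := tendsto_lintegral_of_dominated_convergence (μ := (volume : Measure I))
    (F := fun n x => edist (p n x) (g x)) (f := fun _ => 0) (fun _ => 1)
    (fun n => (hp n).1.edist hg) (fun n => ae_of_all _ fun x => edist_le_one _ _) (by simp) ?_
  · simpa [meanDist] using ht
  · filter_upwards [hpg] with x hx
    simpa using hx.edist (tendsto_const_nhds (x := g x))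

lemma ae_comp_eq_id_of_tendsto {T : ℕ → I ≃ I}
    (hT : ∀ n, MeasurePreserving (T n) volume volume)
    (hT' : ∀ n, MeasurePreserving (T n).symm volume volume) {g h : I → I}
    (hg : MeasurePreserving g volume volume) (hh : MeasurePreserving h volume volume)
    (hTg : Tendsto (fun n => meanDist volume (T n) g) atTop (𝓝 0))
    (hTh : Tendsto (fun n => meanDist volume (T n).symm h) atTop (𝓝 0)) :
    ∀ᵐ x, g (h x) = x := by
  have h1 : Tendsto (fun n => meanDist volume (g ∘ (T n).symm) (g ∘ h)) atTop (𝓝 0) :=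
    tendsto_zero_of_le_add_mul (fun ε hε => by
      obtain ⟨C, hC⟩ := exists_meanDist_comp_le hg.1 hε
      exact ⟨C, fun n => hC volume _ _ (hT' n) hh⟩) hTh
  have h2 : ∀ n, meanDist volume id (g ∘ h) ≤
      meanDist volume (T n) g + meanDist volume (g ∘ (T n).symm) (g ∘ h) := fun n => by
    have h3 : meanDist volume id (g ∘ (T n).symm) = meanDist volume (T n) g := by
      rw [← meanDist_comp (hT' n) (hT n).1 hg.1, Equiv.self_comp_symm]
    rw [← h3]
    exact meanDist_triangle measurable_id (hg.1.comp (hT' n).1)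
  have h4 : meanDist volume id (g ∘ h) = 0 := by
    have := ge_of_tendsto' (hTg.add h1) h2
    simpa using this
  rw [meanDist, lintegral_eq_zero_iff (measurable_id.edist (hg.1.comp hh.1))] at h4
  filter_upwards [h4] with x hx
  exact (edist_eq_zero.1 hx).symm

lemma exists_autDist_limit {T : ℕ → Aut01} (h : ∑' n, autDist (T n) (T (n + 1)) ≠ ∞) :
    ∃ S, Tendsto T atTop (𝓝 S) := by
  have hT := fun n => (T n).measurePreserving_toFun
  have hT' := fun n => (T n).measurePreserving_invFun
  obtain ⟨g, hg, hTg⟩ := exists_meanDist_limit hT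
    (ne_top_of_le_ne_top h (ENNReal.tsum_le_tsum fun _ => le_self_add))
  obtain ⟨k, hk, hTk⟩ := exists_meanDist_limit hT'
    (ne_top_of_le_ne_top h (ENNReal.tsum_le_tsum fun _ => le_add_self))
  have hgk : ∀ᵐ x, g (k x) = x := ae_comp_eq_id_of_tendsto hT hT' hg hk hTg hTk
  have hkg : ∀ᵐ x, k (g x) = x :=
    ae_comp_eq_id_of_tendsto (T := fun n => (T n).toEquiv.symm) hT' hT hk hg hTk hTg
  obtain ⟨D, hD, hD0, hDc⟩ := exists_uncountable_null
  obtain ⟨e, he⟩ := exists_measurableEquiv_ae_eq hg (S := {x | k (g x) = x})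
    (measurableSet_eq_fun (hk.1.comp hg.1) measurable_id) hkg
    (fun x hx y hy hxy => by
      rw [← show k (g x) = x from hx, ← show k (g y) = y from hy, hxy]) hD hD0 hDc hD hD0 hDc
  have hemp : MeasurePreserving e volume volume :=
    ⟨e.measurable, by rw [Measure.map_congr he, hg.map_eq]⟩
  refine ⟨⟨e.toEquiv, hemp, hemp.symm e⟩, tendsto_nhds_iff.2 ?_⟩
  refine hTg.congr fun n => ?_
  rw [meanDist_comm]
  exact meanDist_congr he.symm (EventuallyEq.refl _ _)

lemma baireSpace : BaireSpace Aut01 := by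
  let inst : PseudoMetricSpace Aut01 :=
    PseudoMetricSpace.ofDistTopology (fun S T => (autDist S T).toReal)
      (fun S => by simp [autDist, meanDist_self])
      (fun S T => by
        simp only [autDist]
        rw [meanDist_comm, meanDist_comm (p := S.toEquiv.symm)])
      (fun S T R => by
        rw [← ENNReal.toReal_add (autDist_ne_top _ _) (autDist_ne_top _ _)]
        exact ENNReal.toReal_mono
          (ENNReal.add_ne_top.2 ⟨autDist_ne_top _ _, autDist_ne_top _ _⟩) (autDist_triangle S T R))
      (fun s => by
        rw [isOpen_iff_comap]
        refine forall₂_congr fun S _ => ?_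
        have hreal : comap (autDist S) (𝓝 0) = comap (fun T => (autDist S T).toReal) (𝓝 0) := by
          refine le_antisymm (tendsto_iff_comap.1 ?_) (tendsto_iff_comap.1 ?_)
          · exact ENNReal.toReal_zero ▸
              (ENNReal.tendsto_toReal ENNReal.zero_ne_top).comp tendsto_comap
          · have h := ENNReal.tendsto_ofReal
              (tendsto_comap (f := fun T => (autDist S T).toReal) (x := 𝓝 0))
            simpa [ENNReal.ofReal_toReal (autDist_ne_top _ _)] using h
        rw [hreal, (Metric.nhds_basis_ball.comap _).mem_iff]
        simp [Set.subset_def])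
  have hcomplete : CompleteSpace Aut01 := by
    refine Metric.complete_of_convergent_controlled_sequences (fun n => (1 / 2) ^ n)
      (by simp) fun u hu => exists_autDist_limit (ne_top_of_le_ne_top ?_
        (ENNReal.tsum_le_tsum (g := fun n => ENNReal.ofReal ((1 / 2) ^ n)) fun n => ?_))
    · rw [← ENNReal.ofReal_tsum_of_nonneg (fun n => by positivity) summable_geometric_two]
      exact ENNReal.ofReal_ne_top
    · rw [← ENNReal.ofReal_toReal (autDist_ne_top _ _)]
      exact ENNReal.ofReal_le_ofReal (hu n n (n + 1) le_rfl n.le_succ).le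
  infer_instance

lemma coe_zpow_natCast (T : Aut01) (n : ℕ) :
    ⇑(T.toEquiv ^ (n : ℤ) : Equiv.Perm I) = T.toEquiv^[n] := by
  rw [zpow_natCast, Equiv.Perm.iterate_eq_pow]

lemma measurePreserving_iterate (T : Aut01) (n : ℕ) :
    MeasurePreserving T.toEquiv^[n] (volume : Measure I) volume :=
  T.measurePreserving_toFun.iterate n

lemma tendsto_meanDist_iterate {ι : Type*} {l : Filter ι} {u : ι → Aut01} {S : Aut01}
    (h : Tendsto u l (𝓝 S)) (n : ℕ) :
    Tendsto (fun i => meanDist volume S.toEquiv^[n] (u i).toEquiv^[n]) l (𝓝 0) := by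
  rw [tendsto_nhds_iff] at h
  induction n with
  | zero => simpa [meanDist_self] using tendsto_const_nhds
  | succ n ih =>
    have h1 : Tendsto (fun i => meanDist volume (S.toEquiv ∘ S.toEquiv^[n])
        (S.toEquiv ∘ (u i).toEquiv^[n])) l (𝓝 0) :=
      tendsto_zero_of_le_add_mul (fun ε hε => by
        obtain ⟨C, hC⟩ := exists_meanDist_comp_le S.measurable_coe hε
        exact ⟨C, fun i => hC volume _ _ (S.measurePreserving_iterate n)
          ((u i).measurePreserving_iterate n)⟩) ih
    refine tendsto_of_tendsto_of_tendsto_of_le_of_le tendsto_const_nhds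
      (by simpa using h1.add h) (fun _ => zero_le) fun i => ?_
    simp only [Function.iterate_succ']
    rw [← meanDist_comp ((u i).measurePreserving_iterate n) S.measurable_coe
      (u i).measurable_coe]
    exact meanDist_triangle (S.measurable_coe.comp (S.measurePreserving_iterate n).1)
      (S.measurable_coe.comp ((u i).measurePreserving_iterate n).1)

lemma abs_measureReal_inter_sub_le {Z : Type*} [MeasurableSpace Z] (μ : Measure Z)
    [IsProbabilityMeasure μ] {A A' B B' : Set Z} (hA : MeasurableSet A)
    (hA' : MeasurableSet A') (hB : MeasurableSet B) (hB' : MeasurableSet B') :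
    |μ.real (A ∩ B) - μ.real (A' ∩ B')| ≤ μ.real (A ∆ A') + μ.real (B ∆ B') := by
  refine (abs_measureReal_sub_le_measureReal_symmDiff (hA.inter hB).nullMeasurableSet
    (hA'.inter hB').nullMeasurableSet).trans
    ((measureReal_mono ?_).trans (measureReal_union_le _ _))
  intro z
  simp only [Set.mem_symmDiff, Set.mem_inter_iff, Set.mem_union]
  tauto

lemma corr_eq (T : Aut01) (n : ℕ) (A B : Set I) :
    T.corr n A B = volume.real (A ∩ T.toEquiv^[n] ⁻¹' B) := by
  rw [corr, coe_zpow_natCast, measureReal_def]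

lemma continuous_corr (n : ℕ) {A B : Set I} (hA : MeasurableSet A) (hB : MeasurableSet B) :
    Continuous fun T : Aut01 => T.corr n A B := by
  refine continuous_iff_continuousAt.2 fun S => ?_
  have h : Tendsto (fun T : Aut01 =>
      volume ((S.toEquiv^[n] ⁻¹' B) ∆ (T.toEquiv^[n] ⁻¹' B))) (𝓝 S) (𝓝 0) :=
    tendsto_zero_of_le_add_mul (fun ε hε => by
      obtain ⟨C, hC⟩ := exists_measure_symmDiff_preimage_le hB hε
      exact ⟨C, fun T => hC volume _ _ (S.measurePreserving_iterate n)
        (T.measurePreserving_iterate n)⟩) (tendsto_meanDist_iterate tendsto_id n)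
  have h' := (ENNReal.tendsto_toReal ENNReal.zero_ne_top).comp h
  refine tendsto_iff_dist_tendsto_zero.2 (squeeze_zero (fun _ => dist_nonneg) (fun T => ?_) h')
  rw [dist_comm, Real.dist_eq]
  simp only [corr_eq]
  refine (abs_measureReal_inter_sub_le volume hA hA ((S.measurePreserving_iterate n).1 hB)
    ((T.measurePreserving_iterate n).1 hB)).trans (le_of_eq ?_)
  simp [measureReal_def]

lemma abs_corr_sub_le (T : Aut01) (n : ℕ) {A A' B B' : Set I} (hA : MeasurableSet A)
    (hA' : MeasurableSet A') (hB : MeasurableSet B) (hB' : MeasurableSet B') :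
    |T.corr n A B - T.corr n A' B'| ≤ volume.real (A ∆ A') + volume.real (B ∆ B') := by
  have hT := T.measurePreserving_iterate n
  rw [corr_eq, corr_eq]
  refine (abs_measureReal_inter_sub_le volume hA hA' (hT.1 hB) (hT.1 hB')).trans (le_of_eq ?_)
  rw [← Set.preimage_symmDiff, hT.measureReal_preimage (hB.symmDiff hB').nullMeasurableSet]

/-- The correlation of `A` and `B` in a `lam`-mixing limit. -/
def mixCorr (lam : ℝ) (A B : Set I) : ℝ :=
  (1 - lam) * (volume (A ∩ B)).toReal + lam * (volume A).toReal * (volume B).toReal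

lemma abs_mixCorr_sub_le {lam : ℝ} (hlam : lam ∈ Set.Icc (0 : ℝ) 1) {A A' B B' : Set I}
    (hA : MeasurableSet A) (hA' : MeasurableSet A') (hB : MeasurableSet B)
    (hB' : MeasurableSet B') :
    |mixCorr lam A B - mixCorr lam A' B'| ≤ volume.real (A ∆ A') + volume.real (B ∆ B') := by
  have h1 := abs_measureReal_inter_sub_le (volume : Measure I) hA hA' hB hB'
  have h2 : |volume.real A * volume.real B - volume.real A' * volume.real B'| ≤
      volume.real (A ∆ A') + volume.real (B ∆ B') := by
    have ha : |volume.real A - volume.real A'| ≤ volume.real (A ∆ A') :=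
      abs_measureReal_sub_le_measureReal_symmDiff hA.nullMeasurableSet hA'.nullMeasurableSet
    have hb : |volume.real B - volume.real B'| ≤ volume.real (B ∆ B') :=
      abs_measureReal_sub_le_measureReal_symmDiff hB.nullMeasurableSet hB'.nullMeasurableSet
    calc |volume.real A * volume.real B - volume.real A' * volume.real B'|
        = |(volume.real A - volume.real A') * volume.real B +
          volume.real A' * (volume.real B - volume.real B')| := by ring_nf
      _ ≤ |volume.real A - volume.real A'| * volume.real B +
          volume.real A' * |volume.real B - volume.real B'| := by
          refine (abs_add_le _ _).trans (le_of_eq ?_)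
          rw [abs_mul, abs_mul, abs_of_nonneg (measureReal_nonneg (s := B)),
            abs_of_nonneg (measureReal_nonneg (s := A'))]
      _ ≤ volume.real (A ∆ A') * 1 + 1 * volume.real (B ∆ B') := by
          gcongr <;> exact measureReal_le_one
      _ = _ := by ring
  calc |mixCorr lam A B - mixCorr lam A' B'|
      = |(1 - lam) * (volume.real (A ∩ B) - volume.real (A' ∩ B')) +
        lam * (volume.real A * volume.real B - volume.real A' * volume.real B')| := by
        simp only [mixCorr, measureReal_def]; ring_nf
    _ ≤ (1 - lam) * |volume.real (A ∩ B) - volume.real (A' ∩ B')| +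
        lam * |volume.real A * volume.real B - volume.real A' * volume.real B'| := by
        refine (abs_add_le _ _).trans (le_of_eq ?_)
        rw [abs_mul, abs_mul, abs_of_nonneg hlam.1, abs_of_nonneg (sub_nonneg.2 hlam.2)]
    _ ≤ (1 - lam) * (volume.real (A ∆ A') + volume.real (B ∆ B')) +
        lam * (volume.real (A ∆ A') + volume.real (B ∆ B')) :=
        add_le_add (mul_le_mul_of_nonneg_left h1 (sub_nonneg.2 hlam.2))
          (mul_le_mul_of_nonneg_left h2 hlam.1)
    _ = _ := by ring

/-- The transformations that are `lam`-mixing along a subsequence of `m`. -/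
def mixingSet (m : ℕ → ℕ) (lam : ℝ) : Set Aut01 :=
  {T | ∃ kseq : ℕ → ℕ, StrictMono kseq ∧
    ∀ A B : Set I, MeasurableSet A → MeasurableSet B →
      Tendsto (fun ℓ => T.corr (m (kseq ℓ) : ℤ) A B) atTop (𝓝 (mixCorr lam A B))}

/-- The transformations whose correlations of `a 0, …, a n` at some time `m k` with `n ≤ k` are
`1 / (n + 1)`-close to those of a `lam`-mixing limit. -/
def nearMixing (m : ℕ → ℕ) (lam : ℝ) (a : ℕ → Set I) (n : ℕ) : Set Aut01 :=
  {T | ∃ k, n ≤ k ∧ ∀ i ∈ Finset.range (n + 1), ∀ j ∈ Finset.range (n + 1),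
    |T.corr (m k) (a i) (a j) - mixCorr lam (a i) (a j)| < 1 / ((n : ℝ) + 1)}

lemma isOpen_nearMixing {m : ℕ → ℕ} {lam : ℝ} {a : ℕ → Set I}
    (ha : ∀ i, MeasurableSet (a i)) (n : ℕ) : IsOpen (nearMixing m lam a n) := by
  have : nearMixing m lam a n = ⋃ k, ⋃ _ : n ≤ k, ⋂ i ∈ Finset.range (n + 1),
      ⋂ j ∈ Finset.range (n + 1), {T : Aut01 |
        |T.corr (m k) (a i) (a j) - mixCorr lam (a i) (a j)| < 1 / ((n : ℝ) + 1)} := by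
    ext T; simp [nearMixing]
  rw [this]
  refine isOpen_iUnion fun k => isOpen_iUnion fun _ => isOpen_biInter_finset fun i _ =>
    isOpen_biInter_finset fun j _ => isOpen_lt ?_ continuous_const
  exact ((continuous_corr (m k) (ha i) (ha j)).sub continuous_const).abs

lemma mixingSet_eq_iInter {m : ℕ → ℕ} {lam : ℝ} (hlam : lam ∈ Set.Icc (0 : ℝ) 1)
    {a : ℕ → Set I} (ha : (volume : Measure I).MeasureDense (Set.range a)) :
    mixingSet m lam = ⋂ n, nearMixing m lam a n := by
  have ham : ∀ i, MeasurableSet (a i) := fun i => ha.measurable _ ⟨i, rfl⟩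
  ext T
  rw [Set.mem_iInter]
  constructor
  · rintro ⟨κ, hκ, h⟩ n
    have hev : ∀ᶠ ℓ in atTop, ∀ i ∈ Finset.range (n + 1), ∀ j ∈ Finset.range (n + 1),
        |T.corr (m (κ ℓ)) (a i) (a j) - mixCorr lam (a i) (a j)| < 1 / ((n : ℝ) + 1) := by
      refine (eventually_all_finset _).2 fun i _ => (eventually_all_finset _).2 fun j _ => ?_
      exact (Metric.tendsto_nhds.1 (h _ _ (ham i) (ham j)) _ Nat.one_div_pos_of_nat)
    obtain ⟨ℓ, hℓ, hn⟩ := (hev.and (eventually_ge_atTop n)).exists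
    exact ⟨κ ℓ, hn.trans (hκ.id_le ℓ), hℓ⟩
  · intro h
    choose κ hκ hT using h
    obtain ⟨φ, hφ, hκφ⟩ := strictMono_subseq_of_id_le hκ
    refine ⟨κ ∘ φ, hκφ, fun A B hA hB => Metric.tendsto_atTop.2 fun ε hε => ?_⟩
    obtain ⟨_, ⟨i, rfl⟩, hi⟩ := ha.approx A hA (measure_ne_top _ _) (ε / 5) (by positivity)
    obtain ⟨_, ⟨j, rfl⟩, hj⟩ := ha.approx B hB (measure_ne_top _ _) (ε / 5) (by positivity)
    have hi' : volume.real (A ∆ a i) < ε / 5 := ENNReal.toReal_lt_of_lt_ofReal hi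
    have hj' : volume.real (B ∆ a j) < ε / 5 := ENNReal.toReal_lt_of_lt_ofReal hj
    obtain ⟨N, hN⟩ := exists_nat_one_div_lt (show 0 < ε / 5 by positivity)
    refine ⟨max N (max i j), fun ℓ hℓ => ?_⟩
    have hℓ' := hℓ.trans (hφ.id_le ℓ)
    simp only [max_le_iff] at hℓ'
    have h1 := hT (φ ℓ) i (Finset.mem_range.2 (by omega)) j (Finset.mem_range.2 (by omega))
    have h2 : 1 / ((φ ℓ : ℝ) + 1) ≤ 1 / ((N : ℝ) + 1) :=
      Nat.one_div_le_one_div hℓ'.1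
    have h3 := T.abs_corr_sub_le (m (κ (φ ℓ))) hA (ham i) hB (ham j)
    have h4 := abs_mixCorr_sub_le hlam hA (ham i) hB (ham j)
    rw [Real.dist_eq]
    simp only [Function.comp_apply]
    rw [abs_lt] at h1 ⊢
    rw [abs_le] at h3 h4
    constructor <;> linarith [h1.1, h1.2, h3.1, h3.2, h4.1, h4.2]

lemma isGδ_and_dense_mixingSet {m : ℕ → ℕ} {lam : ℝ} (hlam : lam ∈ Set.Icc (0 : ℝ) 1)
    (h : ∀ a : ℕ → Set I, (∀ i, MeasurableSet (a i)) → ∀ n, Dense (nearMixing m lam a n)) :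
    IsGδ (mixingSet m lam) ∧ Dense (mixingSet m lam) := by
  obtain ⟨𝒜, hc, hd⟩ := exists_countable_measureDense (volume : Measure I)
  obtain ⟨a, rfl⟩ := hc.exists_eq_range hd.nonempty
  have ham : ∀ i, MeasurableSet (a i) := fun i => hd.measurable _ ⟨i, rfl⟩
  have := baireSpace
  rw [mixingSet_eq_iInter hlam hd]
  exact ⟨.iInter_of_isOpen fun n => isOpen_nearMixing ham n,
    dense_iInter_of_isOpen_nat (fun n => isOpen_nearMixing ham n) fun n => h a ham n⟩

/-- The involution of the cube exchanging the last two coordinates where the first one is less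
than `lam`. -/
def partialSwap (lam : ℝ) (w : I × I × I) : I × I × I :=
  (w.1, if (w.1 : ℝ) < lam then w.2.swap else w.2)

lemma partialSwap_involutive (lam : ℝ) : Function.Involutive (partialSwap lam) := by
  intro w
  by_cases h : (w.1 : ℝ) < lam <;> simp [partialSwap, h]

lemma measurableSet_fst_lt {Y : Type*} [MeasurableSpace Y] (lam : ℝ) :
    MeasurableSet {w : I × Y | (w.1 : ℝ) < lam} :=
  measurableSet_lt (measurable_subtype_coe.comp measurable_fst) measurable_const

lemma measurePreserving_partialSwap (lam : ℝ) :
    MeasurePreserving (partialSwap lam) volume volume := by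
  refine (MeasurePreserving.id (volume : Measure I)).skew_product
    (μc := (volume : Measure (I × I)))
    (g := fun (u : I) (v : I × I) => if (u : ℝ) < lam then v.swap else v) ?_
    (ae_of_all _ fun u => ?_)
  · exact Measurable.ite (measurableSet_fst_lt lam) (measurable_swap.comp measurable_snd)
      measurable_snd
  · by_cases h : (u : ℝ) < lam
    · simp only [h, if_true]
      exact (Measure.measurePreserving_swap (μ := (volume : Measure I))
        (ν := (volume : Measure I))).map_eq
    · simp [h]

lemma volume_coe_lt {lam : ℝ} (hlam : lam ∈ Set.Icc (0 : ℝ) 1) :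
    volume {u : I | (u : ℝ) < lam} = ENNReal.ofReal lam := by
  have : {u : I | (u : ℝ) < lam} = Set.Iio ⟨lam, hlam⟩ := by
    ext u; simp [← Subtype.coe_lt_coe]
  rw [this, unitInterval.volume_Iio]

lemma volume_partialSwap_inter {lam : ℝ} (hlam : lam ∈ Set.Icc (0 : ℝ) 1) {A B : Set I}
    (hA : MeasurableSet A) (hB : MeasurableSet B) :
    volume {w : I × I × I | w.2.1 ∈ A ∧ (partialSwap lam w).2.1 ∈ B} =
      ENNReal.ofReal (mixCorr lam A B) := by
  have hfst : Measurable fun w : I × I × I => w.2.1 := measurable_snd.fst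
  have hm : MeasurableSet {w : I × I × I | w.2.1 ∈ A ∧ (partialSwap lam w).2.1 ∈ B} :=
    (hfst hA).inter ((hfst.comp (measurePreserving_partialSwap lam).1) hB)
  have hU : MeasurableSet {u : I | (u : ℝ) < lam} :=
    measurableSet_lt measurable_subtype_coe measurable_const
  have hUc : volume {u : I | (u : ℝ) < lam}ᶜ = ENNReal.ofReal (1 - lam) := by
    rw [prob_compl_eq_one_sub hU, volume_coe_lt hlam, ENNReal.ofReal_sub _ hlam.1,
      ENNReal.ofReal_one]
  rw [Measure.volume_eq_prod, Measure.prod_apply hm, ← lintegral_add_compl _ hU,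
    setLIntegral_congr_fun (g := fun _ => volume A * volume B) hU,
    setLIntegral_congr_fun (g := fun _ => volume (A ∩ B)) hU.compl, setLIntegral_const,
    setLIntegral_const, hUc, volume_coe_lt hlam, mixCorr, add_comm,
    ENNReal.ofReal_add, ENNReal.ofReal_mul (sub_nonneg.2 hlam.2), mul_assoc lam,
    ENNReal.ofReal_mul hlam.1, ENNReal.ofReal_mul ENNReal.toReal_nonneg,
    ENNReal.ofReal_toReal (measure_ne_top _ _), ENNReal.ofReal_toReal (measure_ne_top _ _),
    ENNReal.ofReal_toReal (measure_ne_top _ _), mul_comm (volume (A ∩ B)),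
    mul_comm (volume A * volume B)]
  · exact mul_nonneg (sub_nonneg.2 hlam.2) ENNReal.toReal_nonneg
  · exact mul_nonneg (mul_nonneg hlam.1 ENNReal.toReal_nonneg) ENNReal.toReal_nonneg
  · intro u hu
    have hu' : ¬ (u : ℝ) < lam := hu
    have : Prod.mk u ⁻¹' {w : I × I × I | w.2.1 ∈ A ∧ (partialSwap lam w).2.1 ∈ B} =
        (A ∩ B) ×ˢ Set.univ := by
      ext v; simp [partialSwap, hu']
    simp only [this]
    rw [Measure.volume_eq_prod, Measure.prod_prod, measure_univ, mul_one]
  · intro u hu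
    have hu' : (u : ℝ) < lam := hu
    have : Prod.mk u ⁻¹' {w : I × I × I | w.2.1 ∈ A ∧ (partialSwap lam w).2.1 ∈ B} =
        A ×ˢ B := by
      ext v; simp [partialSwap, hu']
    simp only [this]
    rw [Measure.volume_eq_prod, Measure.prod_prod]

lemma volume_fst_eq (x : I) : volume {w : I × I × I | w.1 = x} = 0 := by
  have : {w : I × I × I | w.1 = x} = {x} ×ˢ Set.univ := by ext; simp
  rw [this, Measure.volume_eq_prod, Measure.prod_prod, measure_singleton, zero_mul]

/-- The normalised measure on a tower of `N + 1` copies of the cube. -/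
def towerMeasure (N : ℕ) : Measure (Fin (N + 1) × (I × I × I)) :=
  (((N + 1 : ℕ) : ℝ≥0∞)⁻¹ • Measure.count).prod volume

lemma lintegral_levels (N : ℕ) (f : Fin (N + 1) → ℝ≥0∞) :
    ∫⁻ i, f i ∂(((N + 1 : ℕ) : ℝ≥0∞)⁻¹ • Measure.count) =
      ((N + 1 : ℕ) : ℝ≥0∞)⁻¹ * ∑ i, f i := by
  rw [lintegral_smul_measure, lintegral_count, tsum_fintype, smul_eq_mul]

lemma towerMeasure_apply {N : ℕ} {s : Set (Fin (N + 1) × (I × I × I))} (hs : MeasurableSet s) :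
    towerMeasure N s =
      ((N + 1 : ℕ) : ℝ≥0∞)⁻¹ * ∑ i, volume (Prod.mk i ⁻¹' s : Set (I × I × I)) := by
  rw [towerMeasure, Measure.prod_apply hs, lintegral_levels]

lemma towerMeasure_apply_of_forall {N : ℕ} {s : Set (Fin (N + 1) × (I × I × I))}
    (hs : MeasurableSet s) {c : ℝ≥0∞}
    (h : ∀ i, volume (Prod.mk i ⁻¹' s : Set (I × I × I)) = c) : towerMeasure N s = c := by
  rw [towerMeasure_apply hs]
  simp only [h, Finset.sum_const, Finset.card_univ, Fintype.card_fin, nsmul_eq_mul]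
  rw [← mul_assoc, ENNReal.inv_mul_cancel (by simp) (ENNReal.natCast_ne_top _), one_mul]

instance (N : ℕ) : IsProbabilityMeasure (towerMeasure N) :=
  ⟨towerMeasure_apply_of_forall .univ fun i => by simp⟩

instance (N : ℕ) : NullSingletonClass (towerMeasure N) := by
  refine ⟨fun z => ?_⟩
  rw [towerMeasure_apply (measurableSet_singleton z)]
  have h : ∀ i, volume (Prod.mk i ⁻¹' {z} : Set (I × I × I)) = 0 := fun i =>
    measure_mono_null (t := {w | w.1 = z.2.1})
      (fun w hw => congrArg (fun z : Fin (N + 1) × (I × I × I) => z.2.1) hw) (volume_fst_eq _)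
  simp [h]

lemma towerMeasure_top (N : ℕ) :
    towerMeasure N (Prod.fst ⁻¹' {Fin.last N}) = ((N + 1 : ℕ) : ℝ≥0∞)⁻¹ := by
  rw [towerMeasure_apply (measurable_fst (measurableSet_singleton _)),
    Finset.sum_eq_single (Fin.last N)]
  · have : (Prod.mk (Fin.last N) ⁻¹' (Prod.fst ⁻¹' {Fin.last N}) : Set (I × I × I)) =
        Set.univ := by ext; simp
    rw [this, measure_univ, mul_one]
  · intro i _ hi
    have : (Prod.mk i ⁻¹' (Prod.fst ⁻¹' {Fin.last N}) : Set (I × I × I)) = ∅ := by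
      ext; simp [hi]
    rw [this, measure_empty]
  · simp

/-- The cyclic tower transformation, with return map `partialSwap lam`. -/
def towerMap (N : ℕ) (lam : ℝ) :
    Fin (N + 1) × (I × I × I) ≃ Fin (N + 1) × (I × I × I) :=
  Equiv.prodShear (finRotate (N + 1)) fun i =>
    if i = Fin.last N then (partialSwap_involutive lam).toPerm else Equiv.refl _

lemma towerMap_apply (N : ℕ) (lam : ℝ) (z : Fin (N + 1) × (I × I × I)) :
    towerMap N lam z = (z.1 + 1, if z.1 = Fin.last N then partialSwap lam z.2 else z.2) := by
  by_cases h : z.1 = Fin.last N <;> simp [towerMap, h]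

lemma measurePreserving_towerMap (N : ℕ) (lam : ℝ) :
    MeasurePreserving (towerMap N lam) (towerMeasure N) (towerMeasure N) := by
  have hR : ∀ i : Fin (N + 1), MeasurePreserving
      (fun w => if i = Fin.last N then partialSwap lam w else w) volume volume := by
    intro i
    by_cases h : i = Fin.last N
    · simpa [h] using measurePreserving_partialSwap lam
    · simp only [h, if_false]
      exact MeasurePreserving.id (volume : Measure (I × I × I))
  have hm : Measurable (towerMap N lam) := measurable_from_prod_countable_right fun i => by
    simp only [towerMap_apply]
    exact measurable_const.prodMk (hR i).1
  refine ⟨hm, Measure.ext fun s hs => ?_⟩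
  rw [Measure.map_apply hm hs, towerMeasure_apply (hm hs), towerMeasure_apply hs]
  congr 1
  refine (Finset.sum_congr rfl fun i _ => ?_).trans
    (Equiv.sum_comp (finRotate (N + 1)) fun i => volume (Prod.mk i ⁻¹' s : Set (I × I × I)))
  rw [finRotate_apply,
    ← (hR i).measure_preimage (measurable_prodMk_left hs).nullMeasurableSet]
  congr 1
  ext w
  simp [towerMap_apply]

lemma measurable_towerMap_symm (N : ℕ) (lam : ℝ) : Measurable (towerMap N lam).symm := by
  refine measurable_from_prod_countable_right fun i => ?_
  simp only [towerMap, Equiv.prodShear_symm_apply]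
  refine measurable_const.prodMk ?_
  split_ifs
  · exact (measurePreserving_partialSwap lam).1
  · exact measurable_id

lemma towerMap_iterate (N : ℕ) (lam : ℝ) (i : Fin (N + 1)) (w : I × I × I) :
    (towerMap N lam)^[i] (0, w) = (i, w) := by
  induction i using Fin.induction with
  | zero => rfl
  | succ i ih =>
    rw [Fin.val_succ, Function.iterate_succ_apply', ← Fin.val_castSucc, ih, towerMap_apply]
    simp [(Fin.castSucc_lt_last i).ne]

lemma towerMap_iterate_succ (N : ℕ) (lam : ℝ) (z : Fin (N + 1) × (I × I × I)) :
    (towerMap N lam)^[N + 1] z = (z.1, partialSwap lam z.2) := by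
  have h0 : ∀ w, (towerMap N lam)^[N + 1] (0, w) = (0, partialSwap lam w) := by
    intro w
    have := towerMap_iterate N lam (Fin.last N) w
    rw [Fin.val_last] at this
    rw [Function.iterate_succ_apply', this, towerMap_apply]
    simp
  obtain ⟨i, w⟩ := z
  have h := (Function.Commute.iterate_iterate_self (towerMap N lam) (N + 1) i) (0, w)
  rwa [h0, towerMap_iterate, towerMap_iterate] at h

/-- The factor map of the tower onto `T`, read along the first `N + 1` iterates. -/
def towerCoord (T : Aut01) (N : ℕ) (z : Fin (N + 1) × (I × I × I)) : I :=
  T.toEquiv^[z.1] z.2.2.1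

lemma measurable_towerCoord (T : Aut01) (N : ℕ) : Measurable (towerCoord T N) :=
  measurable_from_prod_countable_right fun i =>
    (T.measurePreserving_iterate i).1.comp measurable_snd.fst

lemma volume_snd_fst_mem (A : Set I) :
    volume {w : I × I × I | w.2.1 ∈ A} = volume A := by
  have : {w : I × I × I | w.2.1 ∈ A} = Set.univ ×ˢ (A ×ˢ Set.univ) := by ext; simp
  rw [this, Measure.volume_eq_prod, Measure.prod_prod, Measure.volume_eq_prod,
    Measure.prod_prod]
  simp

lemma measurePreserving_towerCoord (T : Aut01) (N : ℕ) :
    MeasurePreserving (towerCoord T N) (towerMeasure N) volume := by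
  refine ⟨measurable_towerCoord T N, Measure.ext fun A hA => ?_⟩
  rw [Measure.map_apply (measurable_towerCoord T N) hA]
  refine towerMeasure_apply_of_forall (measurable_towerCoord T N hA) fun i => ?_
  have hT := T.measurePreserving_iterate i
  exact (volume_snd_fst_mem (T.toEquiv^[i] ⁻¹' A)).trans
    (hT.measure_preimage hA.nullMeasurableSet)

lemma mixCorr_preimage {lam : ℝ} {f : I → I} (hf : MeasurePreserving f volume volume)
    {A B : Set I} (hA : MeasurableSet A) (hB : MeasurableSet B) :
    mixCorr lam (f ⁻¹' A) (f ⁻¹' B) = mixCorr lam A B := by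
  rw [mixCorr, mixCorr, ← Set.preimage_inter, hf.measure_preimage hA.nullMeasurableSet,
    hf.measure_preimage hB.nullMeasurableSet,
    hf.measure_preimage (hA.inter hB).nullMeasurableSet]

lemma mixCorr_nonneg {lam : ℝ} (hlam : lam ∈ Set.Icc (0 : ℝ) 1) (A B : Set I) :
    0 ≤ mixCorr lam A B :=
  add_nonneg (mul_nonneg (sub_nonneg.2 hlam.2) ENNReal.toReal_nonneg)
    (mul_nonneg (mul_nonneg hlam.1 ENNReal.toReal_nonneg) ENNReal.toReal_nonneg)

lemma towerMeasure_corr (T : Aut01) (N : ℕ) {lam : ℝ} (hlam : lam ∈ Set.Icc (0 : ℝ) 1)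
    {A B : Set I} (hA : MeasurableSet A) (hB : MeasurableSet B) :
    (towerMeasure N).real (towerCoord T N ⁻¹' A ∩
      (towerMap N lam)^[N + 1] ⁻¹' (towerCoord T N ⁻¹' B)) = mixCorr lam A B := by
  have hφ := measurable_towerCoord T N
  have hm : MeasurableSet (towerCoord T N ⁻¹' A ∩
      (towerMap N lam)^[N + 1] ⁻¹' (towerCoord T N ⁻¹' B)) :=
    (hφ hA).inter (((measurePreserving_towerMap N lam).iterate (N + 1)).1 (hφ hB))
  rw [measureReal_def, towerMeasure_apply_of_forall hm (c := ENNReal.ofReal (mixCorr lam A B)),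
    ENNReal.toReal_ofReal (mixCorr_nonneg hlam A B)]
  intro i
  have hT := T.measurePreserving_iterate i
  rw [← mixCorr_preimage hT hA hB, ← volume_partialSwap_inter hlam (hT.1 hA) (hT.1 hB)]
  congr 1
  ext w
  simp only [Set.mem_preimage, Set.mem_inter_iff, Set.mem_ofPred_eq, towerMap_iterate_succ,
    towerCoord]

lemma towerCoord_towerMap (T : Aut01) (N : ℕ) (lam : ℝ) {z : Fin (N + 1) × (I × I × I)}
    (hz : z.1 ≠ Fin.last N) :
    towerCoord T N (towerMap N lam z) = T.toEquiv (towerCoord T N z) := by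
  rw [towerMap_apply, if_neg hz, towerCoord, towerCoord,
    Fin.val_add_one_of_lt (Fin.lt_last_iff_ne_last.2 hz), Function.iterate_succ_apply']

lemma exists_towerMeasurableEquiv_near (T : Aut01) (N : ℕ) {η : ℝ≥0∞} (hη : η ≠ 0) :
    ∃ e : (Fin (N + 1) × (I × I × I)) ≃ᵐ I, MeasurePreserving e (towerMeasure N) volume ∧
      meanDist (towerMeasure N) e (towerCoord T N) ≤ η := by
  have hm : MeasurableSet {z : Fin (N + 1) × (I × I × I) | z.2.1 = 0} :=
    measurable_snd.fst (measurableSet_singleton 0)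
  refine exists_measurableEquiv_near hm ?_ (fun hc => ?_) (measurePreserving_towerCoord T N) hη
  · exact towerMeasure_apply_of_forall hm fun i => volume_fst_eq 0
  · have h : (Set.univ : Set I).Countable :=
      (hc.image fun z => z.2.2.1).mono fun x _ =>
        (Set.mem_image _ _ _).2 ⟨((0 : Fin (N + 1)), (0 : I), x, x), rfl, rfl⟩
    simpa using h.measure_zero volume

/-- Transport of the tower transformation to the unit interval. -/
def towerAut {N : ℕ} (lam : ℝ) {e : (Fin (N + 1) × (I × I × I)) ≃ᵐ I}
    (he : MeasurePreserving e (towerMeasure N) volume) : Aut01 where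
  toEquiv := (e.toEquiv.symm.trans (towerMap N lam)).trans e.toEquiv
  measurePreserving_toFun :=
    (he.comp (measurePreserving_towerMap N lam)).comp (he.symm e)
  measurePreserving_invFun :=
    (he.comp ((measurePreserving_towerMap N lam).symm
      { toEquiv := towerMap N lam
        measurable_toFun := (measurePreserving_towerMap N lam).1
        measurable_invFun := measurable_towerMap_symm N lam })).comp (he.symm e)

section TowerAut

variable {N : ℕ} {lam : ℝ} {e : (Fin (N + 1) × (I × I × I)) ≃ᵐ I}
  (he : MeasurePreserving e (towerMeasure N) volume)

lemma semiconj_towerAut :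
    Function.Semiconj e (towerMap N lam) (towerAut lam he).toEquiv := fun z => by
  simp [towerAut]

lemma meanDist_towerAut_le (T : Aut01) :
    meanDist volume T.toEquiv (towerAut lam he).toEquiv ≤
      ((N + 1 : ℕ) : ℝ≥0∞)⁻¹ +
        (meanDist (towerMeasure N) (T.toEquiv ∘ e) (T.toEquiv ∘ towerCoord T N) +
        meanDist (towerMeasure N) e (towerCoord T N)) := by
  have hφ := measurable_towerCoord T N
  have hτ := measurePreserving_towerMap N lam
  rw [← meanDist_comp he T.measurable_coe (towerAut lam he).measurable_coe,
    ← (semiconj_towerAut (lam := lam) he).comp_eq]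
  have h1 : meanDist (towerMeasure N) (T.toEquiv ∘ towerCoord T N)
      (towerCoord T N ∘ towerMap N lam) ≤ ((N + 1 : ℕ) : ℝ≥0∞)⁻¹ := by
    rw [← towerMeasure_top N, ← zero_add (towerMeasure N _)]
    refine meanDist_le_add_measure (measurable_fst (measurableSet_singleton _))
      (ae_of_all _ fun z hz => ?_)
    simp only [Function.comp_apply]
    rw [towerCoord_towerMap T N lam (fun h => hz h), edist_self]
  calc meanDist (towerMeasure N) (T.toEquiv ∘ e) (e ∘ towerMap N lam)
      ≤ meanDist (towerMeasure N) (T.toEquiv ∘ e) (T.toEquiv ∘ towerCoord T N) +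
        (meanDist (towerMeasure N) (T.toEquiv ∘ towerCoord T N)
          (towerCoord T N ∘ towerMap N lam) +
        meanDist (towerMeasure N) (towerCoord T N ∘ towerMap N lam) (e ∘ towerMap N lam)) :=
        (meanDist_triangle (T.measurable_coe.comp e.measurable)
          (T.measurable_coe.comp hφ)).trans (by
            gcongr
            exact meanDist_triangle (T.measurable_coe.comp hφ) (hφ.comp hτ.1))
    _ ≤ meanDist (towerMeasure N) (T.toEquiv ∘ e) (T.toEquiv ∘ towerCoord T N) +
        (((N + 1 : ℕ) : ℝ≥0∞)⁻¹ + meanDist (towerMeasure N) e (towerCoord T N)) := by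
        rw [meanDist_comp hτ hφ e.measurable, meanDist_comm (p := towerCoord T N)]
        gcongr
    _ = _ := by ring

lemma abs_corr_towerAut_sub_le (hlam : lam ∈ Set.Icc (0 : ℝ) 1) (T : Aut01) {A B : Set I}
    (hA : MeasurableSet A) (hB : MeasurableSet B) :
    |(towerAut lam he).corr (N + 1 : ℕ) A B - mixCorr lam A B| ≤
      (towerMeasure N).real ((e ⁻¹' A) ∆ (towerCoord T N ⁻¹' A)) +
        (towerMeasure N).real ((e ⁻¹' B) ∆ (towerCoord T N ⁻¹' B)) := by
  have hφ := measurable_towerCoord T N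
  have hτ := (measurePreserving_towerMap N lam).iterate (N + 1)
  have hS := (towerAut lam he).measurePreserving_iterate (N + 1)
  rw [corr_eq, ← he.measureReal_preimage (hA.inter (hS.1 hB)).nullMeasurableSet,
    Set.preimage_inter, ← Set.preimage_comp,
    ← ((semiconj_towerAut (lam := lam) he).iterate_right (N + 1)).comp_eq, Set.preimage_comp,
    ← towerMeasure_corr T N hlam hA hB]
  refine (abs_measureReal_inter_sub_le _ (e.measurable hA) (hφ hA)
    (hτ.1 (e.measurable hB)) (hτ.1 (hφ hB))).trans (le_of_eq ?_)
  rw [← Set.preimage_symmDiff,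
    hτ.measureReal_preimage ((e.measurable hB).symmDiff (hφ hB)).nullMeasurableSet]

end TowerAut

/-- Every transformation is, up to `1 / (N + 1)`, a limit of transformations whose correlations at
time `N + 1` converge to those of a `lam`-mixing limit. -/
lemma exists_seq_tendsto_mixCorr (T : Aut01) (N : ℕ) {lam : ℝ}
    (hlam : lam ∈ Set.Icc (0 : ℝ) 1) :
    ∃ (u : ℕ → Aut01) (v : ℕ → ℝ≥0∞), Tendsto v atTop (𝓝 0) ∧
      (∀ j, meanDist volume T.toEquiv (u j).toEquiv ≤ ((N + 1 : ℕ) : ℝ≥0∞)⁻¹ + v j) ∧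
      ∀ A B, MeasurableSet A → MeasurableSet B →
        Tendsto (fun j => (u j).corr (N + 1 : ℕ) A B) atTop (𝓝 (mixCorr lam A B)) := by
  choose e he hed using fun j : ℕ =>
    exists_towerMeasurableEquiv_near T N (η := (j : ℝ≥0∞)⁻¹) (by simp)
  have h0 : Tendsto (fun j => meanDist (towerMeasure N) (e j) (towerCoord T N)) atTop (𝓝 0) :=
    tendsto_of_tendsto_of_tendsto_of_le_of_le tendsto_const_nhds
      ENNReal.tendsto_inv_nat_nhds_zero (fun _ => zero_le) hed
  have h1 : Tendsto (fun j => meanDist (towerMeasure N) (T.toEquiv ∘ e j)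
      (T.toEquiv ∘ towerCoord T N)) atTop (𝓝 0) :=
    tendsto_zero_of_le_add_mul (fun ε hε => by
      obtain ⟨C, hC⟩ := exists_meanDist_comp_le T.measurable_coe hε
      exact ⟨C, fun j => hC _ _ _ (he j) (measurePreserving_towerCoord T N)⟩) h0
  have h2 : ∀ A, MeasurableSet A → Tendsto (fun j => (towerMeasure N).real
      ((e j ⁻¹' A) ∆ (towerCoord T N ⁻¹' A))) atTop (𝓝 0) := by
    intro A hA
    have : Tendsto (fun j => towerMeasure N ((e j ⁻¹' A) ∆ (towerCoord T N ⁻¹' A)))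
        atTop (𝓝 0) :=
      tendsto_zero_of_le_add_mul (fun ε hε => by
        obtain ⟨C, hC⟩ := exists_measure_symmDiff_preimage_le hA hε
        exact ⟨C, fun j => hC _ _ _ (he j) (measurePreserving_towerCoord T N)⟩) h0
    exact (ENNReal.tendsto_toReal ENNReal.zero_ne_top).comp this
  refine ⟨fun j => towerAut lam (he j), _, by simpa using h1.add h0,
    fun j => meanDist_towerAut_le (he j) T, fun A B hA hB => ?_⟩
  refine tendsto_iff_dist_tendsto_zero.2 (squeeze_zero (fun _ => dist_nonneg) (fun j => ?_)
    (by simpa using (h2 A hA).add (h2 B hB)))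
  rw [Real.dist_eq]
  exact abs_corr_towerAut_sub_le (he j) hlam T hA hB

lemma dense_nearMixing {m : ℕ → ℕ} (hm : StrictMono m) {lam : ℝ}
    (hlam : lam ∈ Set.Icc (0 : ℝ) 1) {a : ℕ → Set I} (ha : ∀ i, MeasurableSet (a i)) (n : ℕ) :
    Dense (nearMixing m lam a n) := by
  intro T
  have key : ∀ j : ℕ, ∃ S ∈ nearMixing m lam a n,
      meanDist volume T.toEquiv S.toEquiv ≤ (j : ℝ≥0∞)⁻¹ + (j : ℝ≥0∞)⁻¹ := by
    intro j
    set k := max n (j + 1) with hk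
    obtain ⟨N, hN⟩ : ∃ N, m k = N + 1 :=
      Nat.exists_eq_add_one.2 (lt_of_lt_of_le (show 0 < k by omega) (hm.id_le k))
    obtain ⟨u, v, hv, hd, hc⟩ := exists_seq_tendsto_mixCorr T N hlam
    have hev : ∀ᶠ l in atTop, ∀ i ∈ Finset.range (n + 1), ∀ i' ∈ Finset.range (n + 1),
        |(u l).corr (N + 1 : ℕ) (a i) (a i') - mixCorr lam (a i) (a i')| <
          1 / ((n : ℝ) + 1) :=
      (eventually_all_finset _).2 fun i _ => (eventually_all_finset _).2 fun i' _ =>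
        Metric.tendsto_nhds.1 (hc _ _ (ha i) (ha i')) _ Nat.one_div_pos_of_nat
    obtain ⟨l, hl, hvl⟩ := (hev.and
      (ENNReal.tendsto_nhds_zero.1 hv (j : ℝ≥0∞)⁻¹ (by simp))).exists
    refine ⟨u l, ⟨k, le_max_left _ _, by rwa [hN]⟩, (hd l).trans (add_le_add ?_ hvl)⟩
    rw [← hN]
    have : j ≤ m k := (show j ≤ k by omega).trans (hm.id_le k)
    gcongr
  choose S hS hd using key
  refine mem_closure_of_tendsto (f := S) (b := atTop) (tendsto_nhds_iff.2 ?_)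
    (.of_forall hS)
  exact tendsto_of_tendsto_of_tendsto_of_le_of_le tendsto_const_nhds
    (by simpa using ENNReal.tendsto_inv_nat_nhds_zero.add ENNReal.tendsto_inv_nat_nhds_zero)
    (fun _ => zero_le) hd

end Aut01

/-- For a strictly increasing `(m_k)` in ℕ and `λ ∈ [0,1]`, the set of
`T` admitting a strictly increasing `(k_ℓ)` with
`μ(A ∩ T^{-m_{k_ℓ}}B) → (1-λ)μ(A∩B) + λ μ(A)μ(B)` for all measurable `A,B`
is a dense `G_δ` in the weak topology. -/
theorem stmt_3 (m : ℕ → ℕ) (hm : StrictMono m) (lam : ℝ) (hlam : lam ∈ Set.Icc (0 : ℝ) 1) :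
    IsGδ {T : Aut01 | ∃ kseq : ℕ → ℕ, StrictMono kseq ∧
        ∀ A B : Set unitInterval, MeasurableSet A → MeasurableSet B →
          Tendsto (fun ℓ => T.corr ((m (kseq ℓ) : ℤ)) A B) atTop
            (𝓝 ((1 - lam) * (volume (A ∩ B)).toReal
              + lam * (volume A).toReal * (volume B).toReal))} ∧
    Dense {T : Aut01 | ∃ kseq : ℕ → ℕ, StrictMono kseq ∧
        ∀ A B : Set unitInterval, MeasurableSet A → MeasurableSet B →
          Tendsto (fun ℓ => T.corr ((m (kseq ℓ) : ℤ)) A B) atTop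
            (𝓝 ((1 - lam) * (volume (A ∩ B)).toReal
              + lam * (volume A).toReal * (volume B).toReal))} := by
  exact Aut01.isGδ_and_dense_mixingSet hlam fun _ ha n => Aut01.dense_nearMixing hm hlam ha n
end
end

section
/- Let N ∈ ℕ and let φ_1, …, φ_N : ℕ → ℤ be asymptotically linearly independent sequences. Then there exists a strictly increasing sequence (n_k)_{k∈ℕ} in ℕ such that for every ξ = (ξ_1,…,ξ_N) ∈ {0,1}^N there exists a weakly mixing T_ξ ∈ Aut([0,1], ℬ, μ) with the property that for each j ∈ {1,…,N} and all measurable A, B ⊆ [0,1], lim_{k→∞} μ(A ∩ T_ξ^{−φ_j(n_k)} B) = (1 − ξ_j) μ(A ∩ B) + ξ_j μ(A) μ(B). -/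
open MeasureTheory Filter Topology

noncomputable section

/-- The means of `|u|` over the finite sets `s k` tend to zero along `F`. -/
def AvgNull {κ : Type*} (s : κ → Finset ℤ) (F : Filter κ) (u : ℤ → ℝ) : Prop :=
  Tendsto (fun k => ((s k).card : ℝ)⁻¹ * ∑ n ∈ s k, |u n|) F (𝓝 0)

/-- Even positive definite real functions on `ℤ`. -/
structure PosDefSeq (r : ℤ → ℝ) : Prop where
  even : ∀ m, r (-m) = r m
  nonneg_sum : ∀ (ι : Type) [Fintype ι] (x : ι → ℤ) (c : ι → ℝ),
    0 ≤ ∑ i, ∑ j, c i * c j * r (x i - x j)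

lemma PosDefSeq.abs_le {r : ℤ → ℝ} (hr : PosDefSeq r) (m : ℤ) : |r m| ≤ r 0 := by
  have h1 := hr.nonneg_sum (Fin 2) ![0, m] ![1, 1]
  have h2 := hr.nonneg_sum (Fin 2) ![0, m] ![1, -1]
  simp [Fin.sum_univ_two, hr.even] at h1 h2
  rw [_root_.abs_le]
  constructor <;> linarith

section Averaging

variable {V : Type} (U : Finset V) (p : V → ℤ)

/-- The positive definite function obtained from `r` by averaging over differences of
elements of `U`, shifted by `p`. -/
def foldAvg (r : ℤ → ℝ) (m : ℤ) : ℝ :=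
  (U.card : ℝ)⁻¹ * ∑ u ∈ U, ∑ v ∈ U, r (m - p u + p v)

lemma PosDefSeq.foldAvg {r : ℤ → ℝ} (hr : PosDefSeq r) : PosDefSeq (foldAvg U p r) where
  even m := by
    simp only [_root_.foldAvg]
    rw [Finset.sum_comm]
    congr 1
    refine Finset.sum_congr rfl fun u _ => Finset.sum_congr rfl fun v _ => ?_
    rw [← hr.even]
    congr 1
    ring
  nonneg_sum ι _ x c := by
    have h := hr.nonneg_sum (ι × U) (fun q => x q.1 - p q.2) (fun q => c q.1)
    have : ∑ i, ∑ j, c i * c j * _root_.foldAvg U p r (x i - x j) =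
        (U.card : ℝ)⁻¹ * ∑ q : ι × U, ∑ q' : ι × U,
          c q.1 * c q'.1 * r (x q.1 - p q.2 - (x q'.1 - p q'.2)) := by
      have hfa : ∀ m, _root_.foldAvg U p r m =
          (U.card : ℝ)⁻¹ * ∑ u : U, ∑ v : U, r (m - p u + p v) := fun m => by
        rw [_root_.foldAvg, ← Finset.sum_coe_sort U]
        congr 1
        exact Finset.sum_congr rfl fun u _ => (Finset.sum_coe_sort U _).symm
      simp only [hfa, Fintype.sum_prod_type, Finset.mul_sum]
      refine Finset.sum_congr rfl fun i _ => ?_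
      rw [Finset.sum_comm]
      refine Finset.sum_congr rfl fun u _ => Finset.sum_congr rfl fun j _ =>
        Finset.sum_congr rfl fun v _ => ?_
      rw [show x i - x j - p u + p v = x i - p u - (x j - p v) by ring]
      ring
    rw [this]
    exact mul_nonneg (by positivity) h

end Averaging

lemma posDefSeq_single : PosDefSeq (fun m => if m = 0 then 1 else 0) where
  even m := by simp
  nonneg_sum ι _ x c := by
    classical
    have : ∑ i, ∑ j, c i * c j * (if x i - x j = 0 then (1 : ℝ) else 0) =
        ∑ y ∈ Finset.univ.image x, (∑ i, if x i = y then c i else 0) ^ 2 := by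
      simp only [sq, Finset.sum_mul_sum]
      rw [Finset.sum_comm (s := Finset.univ.image x)]
      refine Finset.sum_congr rfl fun i _ => ?_
      rw [Finset.sum_comm (s := Finset.univ.image x)]
      refine Finset.sum_congr rfl fun j _ => ?_
      rw [Finset.sum_eq_single (x i)]
      · by_cases h : x i = x j
        · simp [h]
        · simp [sub_eq_zero, h, Ne.symm h]
      · intro b _ hb
        simp [Ne.symm hb]
      · intro h
        exact absurd (Finset.mem_image_of_mem x (Finset.mem_univ i)) h
    rw [this]
    positivity
section Step

variable {N : ℕ} (Z : Finset (Fin N)) (d : ℕ) (t : Fin N → ℤ)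

/-- The box `∏ [0, d)` over the coordinates in `Z`, with zeros elsewhere. -/
def boxOn : Finset (Fin N → ℤ) :=
  Fintype.piFinset fun j => if j ∈ Z then Finset.Ico 0 (d : ℤ) else {0}

/-- The integer combination `∑ⱼ uⱼ tⱼ`. -/
def intComb (u : Fin N → ℤ) : ℤ := ∑ j, u j * t j

lemma intComb_sub (u v : Fin N → ℤ) : intComb t (u - v) = intComb t u - intComb t v := by
  simp [intComb, sub_mul, Finset.sum_sub_distrib]

@[simp] lemma intComb_zero : intComb t 0 = 0 := by simp [intComb]

lemma intComb_single (j : Fin N) : intComb t (Pi.single j 1) = t j := by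
  simp [intComb, Pi.single_apply]

lemma abs_intComb_le {u : Fin N → ℤ} {D : ℕ} (hu : ∀ j, |u j| ≤ D) :
    |intComb t u| ≤ D * ∑ j, |t j| := by
  rw [Finset.mul_sum]
  refine (Finset.abs_sum_le_sum_abs _ _).trans (Finset.sum_le_sum fun j _ => ?_)
  rw [abs_mul]
  exact mul_le_mul_of_nonneg_right (hu j) (abs_nonneg _)

variable {Z d} in
lemma abs_sub_le_of_mem_boxOn {u v : Fin N → ℤ} (hd : 0 < d) (hu : u ∈ boxOn Z d)
    (hv : v ∈ boxOn Z d) (j : Fin N) : |u j - v j| ≤ d - 1 := by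
  have h1 := Fintype.mem_piFinset.1 hu j
  have h2 := Fintype.mem_piFinset.1 hv j
  split_ifs at h1 h2 <;> simp only [Finset.mem_Ico, Finset.mem_singleton] at h1 h2 <;>
    rw [abs_le] <;> constructor <;> omega

lemma card_boxOn_pos (hd : 0 < d) : 0 < (boxOn Z d).card :=
  Finset.card_pos.2 ⟨0, Fintype.mem_piFinset.2 fun j => by split_ifs <;> simp [hd]⟩

variable {t} in
/-- If the integers `tⱼ` are sufficiently independent compared to the support of `r`, then the
averaged function is a multiple of `r` near `intComb t w`. -/
lemma foldAvg_boxOn_apply {r : ℤ → ℝ} {L : ℕ} (hd : 0 < d) (hr : ∀ m, r m ≠ 0 → |m| ≤ L)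
    (hsep : ∀ b : Fin N → ℤ, b ≠ 0 → (∀ j, |b j| ≤ d) → 2 * (L : ℤ) < |intComb t b|)
    {w : Fin N → ℤ} (hw : ∀ j, |w j| ≤ 1) {l : ℤ} (hl : |l| ≤ L) :
    foldAvg (boxOn Z d) (intComb t) r (l + intComb t w) =
      ((boxOn Z d).card : ℝ)⁻¹ *
        ((boxOn Z d ×ˢ boxOn Z d).filter fun q => q.1 - q.2 = w).card * r l := by
  rw [foldAvg, mul_assoc, ← Finset.sum_product', Finset.card_filter]
  push_cast
  rw [Finset.sum_mul]
  congr 1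
  refine Finset.sum_congr rfl fun q hq => ?_
  obtain ⟨hu, hv⟩ := Finset.mem_product.1 hq
  have harg : l + intComb t w - intComb t q.1 + intComb t q.2 =
      l + intComb t (w - (q.1 - q.2)) := by
    rw [intComb_sub, intComb_sub]; ring
  rw [harg]
  split_ifs with h
  · simp [h]
  · rw [zero_mul]
    by_contra hne
    have h1 := hr _ hne
    have h2 := hsep (w - (q.1 - q.2)) (sub_ne_zero.2 (Ne.symm h)) fun j => by
      have h3 := abs_sub_le_of_mem_boxOn hd hu hv j
      have h4 := hw j
      simp only [Pi.sub_apply]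
      rw [abs_le] at h3 h4 ⊢
      constructor <;> omega
    have h3 := abs_sub_abs_le_abs_sub (intComb t (w - (q.1 - q.2))) (-l)
    rw [abs_neg, sub_neg_eq_add, add_comm _ l] at h3
    omega

lemma card_boxOn_diff_zero :
    ((boxOn Z d ×ˢ boxOn Z d).filter fun q => q.1 - q.2 = 0).card = (boxOn Z d).card := by
  refine Finset.card_nbij' Prod.fst (fun u => (u, u)) ?_ ?_ ?_ ?_ <;>
    simp +contextual [Set.MapsTo, Set.LeftInvOn, sub_eq_zero]

lemma card_boxOn_diff_of_notMem {j : Fin N} (hj : j ∉ Z) :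
    ((boxOn Z d ×ˢ boxOn Z d).filter fun q => q.1 - q.2 = Pi.single j 1).card = 0 := by
  rw [Finset.card_eq_zero, Finset.filter_eq_empty_iff]
  rintro ⟨u, v⟩ hq h
  obtain ⟨hu, hv⟩ := Finset.mem_product.1 hq
  have h1 := Fintype.mem_piFinset.1 hu j
  have h2 := Fintype.mem_piFinset.1 hv j
  have h3 := congrFun h j
  simp [hj] at h1 h2 h3
  omega

lemma card_boxOn_diff_of_mem {j : Fin N} (hj : j ∈ Z) (hd : 0 < d) :
    ((boxOn Z d).card : ℝ)⁻¹ *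
      ((boxOn Z d ×ˢ boxOn Z d).filter fun q => q.1 - q.2 = Pi.single j 1).card =
      1 - (d : ℝ)⁻¹ := by
  have h1 : ((boxOn Z d ×ˢ boxOn Z d).filter fun q => q.1 - q.2 = Pi.single j 1).card =
      (Fintype.piFinset fun i => if i = j then Finset.Ico 0 ((d : ℤ) - 1) else
        if i ∈ Z then Finset.Ico 0 (d : ℤ) else {0}).card := by
    refine Finset.card_bij (fun q _ => q.2) ?_ ?_ ?_
    · rintro ⟨u, v⟩ hq
      obtain ⟨hq, h⟩ := Finset.mem_filter.1 hq
      obtain ⟨hu, hv⟩ := Finset.mem_product.1 hq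
      refine Fintype.mem_piFinset.2 fun i => ?_
      have h1 := Fintype.mem_piFinset.1 hu i
      have h2 := Fintype.mem_piFinset.1 hv i
      have h3 := congrFun h i
      dsimp only at h1 h2 h3 ⊢
      by_cases hij : i = j
      · subst hij
        simp [hj] at h1 h2 h3 ⊢
        omega
      · simpa [hij] using h2
    · rintro ⟨u, v⟩ hq ⟨u', v'⟩ hq' h
      have h1 := (Finset.mem_filter.1 hq).2
      have h2 := (Finset.mem_filter.1 hq').2
      dsimp only at h h1 h2
      subst h
      rw [sub_eq_iff_eq_add.1 h1, sub_eq_iff_eq_add.1 h2]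
    · intro v hv
      refine ⟨(Pi.single j 1 + v, v), ?_, rfl⟩
      rw [Finset.mem_filter, Finset.mem_product]
      refine ⟨⟨Fintype.mem_piFinset.2 fun i => ?_, Fintype.mem_piFinset.2 fun i => ?_⟩, by simp⟩
      all_goals
        have h1 := Fintype.mem_piFinset.1 hv i
        by_cases hij : i = j
        · subst hij
          simp [hj] at h1 ⊢
          omega
        · simpa [hij] using h1
  have hcard : (boxOn Z d).card = d * ∏ i ∈ Finset.univ.erase j,
      (if i ∈ Z then Finset.Ico 0 (d : ℤ) else {0}).card := by
    rw [boxOn, Fintype.card_piFinset, ← Finset.mul_prod_erase _ _ (Finset.mem_univ j)]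
    simp [hj]
  have hpos := card_boxOn_pos Z d hd
  rw [h1, Fintype.card_piFinset, ← Finset.mul_prod_erase _ _ (Finset.mem_univ j)]
  have h2 : ∏ i ∈ Finset.univ.erase j, (if i = j then Finset.Ico 0 ((d : ℤ) - 1) else
        if i ∈ Z then Finset.Ico 0 (d : ℤ) else {0}).card =
      ∏ i ∈ Finset.univ.erase j, (if i ∈ Z then Finset.Ico 0 (d : ℤ) else {0}).card :=
    Finset.prod_congr rfl fun i hi => by rw [if_neg (Finset.ne_of_mem_erase hi)]
  rw [h2, hcard]
  rw [hcard] at hpos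
  set P := ∏ i ∈ Finset.univ.erase j, (if i ∈ Z then Finset.Ico 0 (d : ℤ) else {0}).card
  have hP : (P : ℝ) ≠ 0 := by
    have : P ≠ 0 := fun h => by simp [h] at hpos
    exact_mod_cast this
  have hd' : (d : ℝ) ≠ 0 := by positivity
  have h3 : ((d : ℤ) - 1 - 0).toNat = d - 1 := by omega
  simp only [if_true, Int.card_Ico, h3]
  push_cast [Nat.cast_pred hd]
  field_simp

end Step
section Construction

variable {N : ℕ}

/-- Upper bounds for the cardinalities of the supports of the successive approximations. -/
def cardBound (N : ℕ) : ℕ → ℕ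
  | 0 => 1
  | k + 1 => (2 * k + 1) ^ N * cardBound N k

/-- Finite sets carrying the successive approximations. -/
def suppSet (t : ℕ → Fin N → ℤ) : ℕ → Finset ℤ
  | 0 => {0}
  | k + 1 => Finset.image₂ (fun b a => a + intComb (t k) b)
      (Fintype.piFinset fun _ => Finset.Icc (-(k : ℤ)) k) (suppSet t k)

/-- Successive approximations of the covariance function. -/
def approxCov (t : ℕ → Fin N → ℤ) (Z : Finset (Fin N)) : ℕ → ℤ → ℝ
  | 0 => fun m => if m = 0 then 1 else 0
  | k + 1 => foldAvg (boxOn Z (k + 1)) (intComb (t k)) (approxCov t Z k)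

/-- Growth and separation conditions on the integer vectors `t k`. -/
structure Separated (t : ℕ → Fin N → ℤ) (L : ℕ → ℕ) : Prop where
  growth : ∀ k : ℕ, (L k : ℤ) + (k + 1) * ∑ j, |t k j| + 1 ≤ L (k + 1)
  large : ∀ k : ℕ, k * cardBound N k ≤ L k
  sep : ∀ (k : ℕ) (b : Fin N → ℤ), b ≠ 0 → (∀ j, |b j| ≤ k + 1) →
    3 * (L k : ℤ) + 1 + k * cardBound N (k + 1) ≤ |intComb (t k) b|

/-- The limit of the approximations `approxCov`. -/
def limitCov (t : ℕ → Fin N → ℤ) (Z : Finset (Fin N)) (m : ℤ) : ℝ :=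
  approxCov t Z m.natAbs m

variable {t : ℕ → Fin N → ℤ} {L : ℕ → ℕ} (Z : Finset (Fin N))

lemma card_suppSet_le (k : ℕ) : (suppSet t k).card ≤ cardBound N k := by
  induction k with
  | zero => simp [suppSet, cardBound]
  | succ k ih =>
    refine (Finset.card_image₂_le _ _ _).trans (Nat.mul_le_mul ?_ ih)
    rw [Fintype.card_piFinset_const, Int.card_Icc]
    exact Nat.pow_le_pow_left (by omega) _

lemma abs_le_of_mem_suppSet (h : Separated t L) {k : ℕ} {m : ℤ} (hm : m ∈ suppSet t k) :
    |m| ≤ L k := by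
  induction k generalizing m with
  | zero =>
    rw [suppSet, Finset.mem_singleton] at hm
    simp [hm]
  | succ k ih =>
    obtain ⟨b, hb, a, ha, rfl⟩ := Finset.mem_image₂.1 hm
    have h1 := abs_intComb_le (t k) (u := b) (D := k) fun j => by
      have := Fintype.mem_piFinset.1 hb j
      rw [Finset.mem_Icc] at this
      exact _root_.abs_le.2 this
    have h2 := h.growth k
    have h3 : 0 ≤ ∑ j, |t k j| := Finset.sum_nonneg fun _ _ => abs_nonneg _
    have h4 := abs_add_le a (intComb (t k) b)
    have h5 := ih ha
    nlinarith

lemma mem_suppSet_of_ne_zero {k : ℕ} {m : ℤ} (hm : approxCov t Z k m ≠ 0) :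
    m ∈ suppSet t k := by
  induction k generalizing m with
  | zero =>
    by_contra h
    rw [suppSet, Finset.mem_singleton] at h
    simp [approxCov, h] at hm
  | succ k ih =>
    rw [approxCov, foldAvg] at hm
    obtain ⟨u, hu, hm⟩ := Finset.exists_ne_zero_of_sum_ne_zero (right_ne_zero_of_mul hm)
    obtain ⟨v, hv, hm⟩ := Finset.exists_ne_zero_of_sum_ne_zero hm
    refine Finset.mem_image₂.2 ⟨u - v, Fintype.mem_piFinset.2 fun j => ?_, _, ih hm, ?_⟩
    · have := abs_sub_le_of_mem_boxOn (Nat.succ_pos k) hu hv j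
      rw [Finset.mem_Icc, ← _root_.abs_le]
      simpa using this
    · rw [intComb_sub]; ring

lemma posDefSeq_approxCov (k : ℕ) : PosDefSeq (approxCov t Z k) := by
  induction k with
  | zero => exact posDefSeq_single
  | succ k ih => exact ih.foldAvg _ _

lemma approxCov_succ_apply (h : Separated t L) (k : ℕ) {w : Fin N → ℤ} (hw : ∀ j, |w j| ≤ 1)
    {l : ℤ} (hl : |l| ≤ L k) :
    approxCov t Z (k + 1) (l + intComb (t k) w) =
      ((boxOn Z (k + 1)).card : ℝ)⁻¹ * ((boxOn Z (k + 1) ×ˢ boxOn Z (k + 1)).filter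
        fun q => q.1 - q.2 = w).card * approxCov t Z k l := by
  refine foldAvg_boxOn_apply Z (k + 1) (Nat.succ_pos k)
    (fun m hm => abs_le_of_mem_suppSet h (mem_suppSet_of_ne_zero Z hm)) (fun b hb hb' => ?_) hw hl
  have := h.sep k b hb (by simpa using hb')
  have : (0 : ℤ) ≤ k * cardBound N (k + 1) := by positivity
  omega

lemma approxCov_succ_eq (h : Separated t L) (k : ℕ) {l : ℤ} (hl : |l| ≤ L k) :
    approxCov t Z (k + 1) l = approxCov t Z k l := by
  have := approxCov_succ_apply Z h k (w := 0) (by simp) hl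
  rw [intComb_zero, add_zero, card_boxOn_diff_zero, inv_mul_cancel₀, one_mul] at this
  · exact this
  · exact_mod_cast (card_boxOn_pos Z (k + 1) (Nat.succ_pos k)).ne'

lemma Separated.strictMono (h : Separated t L) : StrictMono L :=
  strictMono_nat_of_lt_succ fun k => by
    have := h.growth k
    have : 0 ≤ (k + 1 : ℤ) * ∑ j, |t k j| :=
      mul_nonneg (by positivity) (Finset.sum_nonneg fun _ _ => abs_nonneg _)
    omega

lemma approxCov_eq_of_le (h : Separated t L) {k k' : ℕ} (hk : k ≤ k') {l : ℤ}
    (hl : |l| ≤ L k) : approxCov t Z k' l = approxCov t Z k l := by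
  induction k', hk using Nat.le_induction with
  | base => rfl
  | succ k' hk ih =>
    have : (L k : ℤ) ≤ L k' := by exact_mod_cast h.strictMono.monotone hk
    rw [approxCov_succ_eq Z h k' (hl.trans this), ih]

lemma limitCov_eq (h : Separated t L) {k : ℕ} {l : ℤ} (hl : |l| ≤ L k) :
    limitCov t Z l = approxCov t Z k l := by
  have h1 : |l| ≤ L l.natAbs := by
    have := h.strictMono.id_le l.natAbs
    simp only [id] at this
    have := Int.abs_eq_natAbs l
    omega
  rcases le_total k l.natAbs with hk | hk
  · exact approxCov_eq_of_le Z h hk hl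
  · exact (approxCov_eq_of_le Z h hk h1).symm

lemma Separated.le (h : Separated t L) (k : ℕ) : k ≤ L k := h.strictMono.id_le k

lemma limitCov_zero (h : Separated t L) : limitCov t Z 0 = 1 := by
  rw [limitCov_eq Z h (k := 0) (by simp)]
  simp [approxCov]

lemma posDefSeq_limitCov (h : Separated t L) : PosDefSeq (limitCov t Z) where
  even m := by
    simp only [limitCov, Int.natAbs_neg]
    exact (posDefSeq_approxCov Z _).even m
  nonneg_sum ι _ x c := by
    let K : ℕ := ∑ i, ∑ j, (x i - x j).natAbs
    have hK : ∀ i j, |x i - x j| ≤ L K := by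
      intro i j
      have h1 : (x i - x j).natAbs ≤ ∑ j, (x i - x j).natAbs :=
        Finset.single_le_sum (f := fun j => (x i - x j).natAbs) (fun _ _ => Nat.zero_le _)
          (Finset.mem_univ j)
      have h2 : ∑ j, (x i - x j).natAbs ≤ K :=
        Finset.single_le_sum (f := fun i => ∑ j, (x i - x j).natAbs) (fun _ _ => Nat.zero_le _)
          (Finset.mem_univ i)
      have := h.le K
      have := Int.abs_eq_natAbs (x i - x j)
      omega
    simp only [limitCov_eq Z h (hK _ _)]
    exact (posDefSeq_approxCov Z K).nonneg_sum ι x c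

lemma limitCov_apply_add (h : Separated t L) {k : ℕ} {l : ℤ} (hl : |l| ≤ L k) (j : Fin N) :
    limitCov t Z (t k j + l) =
      (if j ∈ Z then 1 - ((k + 1 : ℕ) : ℝ)⁻¹ else 0) * limitCov t Z l := by
  have h1 : |t k j + l| ≤ L (k + 1) := by
    have h2 := h.growth k
    have h3 : |t k j| ≤ ∑ j, |t k j| :=
      Finset.single_le_sum (f := fun j => |t k j|) (fun _ _ => abs_nonneg _) (Finset.mem_univ j)
    have h4 := abs_add_le (t k j) l
    have h5 := abs_nonneg (t k j)
    nlinarith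
  have hw : ∀ i, |(Pi.single j 1 : Fin N → ℤ) i| ≤ 1 := fun i => by
    rw [Pi.single_apply]; split_ifs <;> simp
  have h2 := approxCov_succ_apply Z h k hw hl
  rw [intComb_single, add_comm l] at h2
  rw [limitCov_eq Z h h1, h2, limitCov_eq Z h hl]
  split_ifs with hj
  · rw [card_boxOn_diff_of_mem Z (k + 1) hj (Nat.succ_pos k)]
  · rw [card_boxOn_diff_of_notMem Z (k + 1) hj]
    simp

lemma Separated.exists_ge (h : Separated t L) (l : ℤ) : ∀ᶠ k in atTop, |l| ≤ L k := by
  filter_upwards [eventually_ge_atTop l.natAbs] with k hk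
  have := h.le k
  have := Int.abs_eq_natAbs l
  omega

/-- The covariance is rigid along `t · j` for `j ∈ Z` and mixing along `t · j` for `j ∉ Z`. -/
lemma tendsto_limitCov (h : Separated t L) (j : Fin N) (l : ℤ) :
    Tendsto (fun k => limitCov t Z (t k j + l)) atTop
      (𝓝 (if j ∈ Z then limitCov t Z l else 0)) := by
  have h1 : Tendsto (fun k : ℕ => (if j ∈ Z then 1 - ((k + 1 : ℕ) : ℝ)⁻¹ else 0) *
      limitCov t Z l) atTop (𝓝 ((if j ∈ Z then 1 else 0) * limitCov t Z l)) := by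
    refine Tendsto.mul_const _ ?_
    split_ifs
    · simpa using tendsto_const_nhds (x := (1 : ℝ)).sub
        ((tendsto_add_atTop_iff_nat 1).2 (tendsto_inv_atTop_nhds_zero_nat (𝕜 := ℝ)))
    · exact tendsto_const_nhds
  rw [ite_mul, one_mul, zero_mul] at h1
  refine h1.congr' ?_
  filter_upwards [h.exists_ge l] with k hk
  exact (limitCov_apply_add Z h hk j).symm

/-- The support of the covariance has density zero. -/
lemma card_support_limitCov_le (h : Separated t L) {k R : ℕ} (hR : L k ≤ R) :
    k * ((Finset.Icc (-(R : ℤ)) R).filter fun m => limitCov t Z m ≠ 0).card ≤ R := by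
  obtain ⟨k', hk, hk1, hk2⟩ : ∃ k', k ≤ k' ∧ L k' ≤ R ∧ R < L (k' + 1) := by
    have hex : ∃ i, R < L i := ⟨R + 1, (h.le (R + 1))⟩
    classical
    have hpos : Nat.find hex ≠ 0 := fun h0 => by
      have h1 := Nat.find_spec hex
      rw [h0] at h1
      have := h.strictMono.monotone (Nat.zero_le k)
      omega
    obtain ⟨i, hi⟩ := Nat.exists_eq_succ_of_ne_zero hpos
    have h1 := Nat.find_spec hex
    rw [hi] at h1
    have h2 : ¬ R < L i := Nat.find_min hex (by omega)
    refine ⟨i, ?_, by omega, h1⟩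
    by_contra! h3
    have := h.strictMono.monotone (show i + 1 ≤ k from h3)
    simp only [Nat.succ_eq_add_one] at h1
    omega
  refine (Nat.mul_le_mul_right _ hk).trans ?_
  set S := (Finset.Icc (-(R : ℤ)) R).filter fun m => limitCov t Z m ≠ 0
  have hS : S ⊆ suppSet t (k' + 1) := by
    intro m hm
    obtain ⟨hm1, hm2⟩ := Finset.mem_filter.1 hm
    rw [Finset.mem_Icc, ← _root_.abs_le] at hm1
    rw [limitCov_eq Z h (k := k' + 1) (by omega)] at hm2
    exact mem_suppSet_of_ne_zero Z hm2
  rcases lt_or_ge R (2 * L k' + 1 + k' * cardBound N (k' + 1)) with hlt | hge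
  · have hS' : S ⊆ suppSet t k' := by
      intro m hm
      obtain ⟨b, hb, a, ha, rfl⟩ := Finset.mem_image₂.1 (hS hm)
      by_cases hb0 : b = 0
      · simpa [hb0] using ha
      exfalso
      have hm1 := (Finset.mem_filter.1 hm).1
      rw [Finset.mem_Icc, ← _root_.abs_le] at hm1
      have h1 := h.sep k' b hb0 fun j => by
        have := Fintype.mem_piFinset.1 hb j
        rw [Finset.mem_Icc, ← _root_.abs_le] at this
        omega
      have h2 := abs_le_of_mem_suppSet h ha
      have h3 := abs_sub_abs_le_abs_sub (intComb (t k') b) (-a)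
      rw [abs_neg, sub_neg_eq_add, add_comm _ a] at h3
      zify at hlt
      linarith
    calc k' * S.card ≤ k' * cardBound N k' :=
          Nat.mul_le_mul_left _ ((Finset.card_le_card hS').trans (card_suppSet_le k'))
      _ ≤ L k' := h.large k'
      _ ≤ R := hk1
  · calc k' * S.card ≤ k' * cardBound N (k' + 1) :=
          Nat.mul_le_mul_left _ ((Finset.card_le_card hS).trans (card_suppSet_le (k' + 1)))
      _ ≤ R := by omega

lemma avgNull_limitCov (h : Separated t L) (l : ℤ) :
    AvgNull (fun M : ℕ => Finset.Icc (1 : ℤ) M) atTop fun n => limitCov t Z (n + l) := by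
  rw [AvgNull, Metric.tendsto_atTop]
  intro ε hε
  obtain ⟨k, hk⟩ := exists_nat_gt (2 / ε)
  have hk0 : 0 < k := by
    have : (0 : ℝ) < k := (by positivity : (0 : ℝ) < 2 / ε).trans hk
    exact_mod_cast this
  refine ⟨L k + l.natAbs + 1, fun M hM => ?_⟩
  set R := M + l.natAbs
  have hcard := card_support_limitCov_le Z h (k := k) (R := R) (by omega)
  set S := (Finset.Icc (-(R : ℤ)) R).filter fun m => limitCov t Z m ≠ 0
  have hsum : ∑ n ∈ Finset.Icc (1 : ℤ) M, |limitCov t Z (n + l)| ≤ S.card := by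
    have hle : ∀ n, |limitCov t Z (n + l)| ≤ if limitCov t Z (n + l) ≠ 0 then 1 else 0 := by
      intro n
      split_ifs with hn
      · exact limitCov_zero Z h ▸ (posDefSeq_limitCov Z h).abs_le _
      · simp [not_not.1 hn]
    refine (Finset.sum_le_sum fun n _ => hle n).trans ?_
    rw [← Finset.sum_filter, Finset.sum_const, nsmul_eq_mul, mul_one, Nat.cast_le]
    refine Finset.card_le_card_of_injOn (fun n => n + l) (fun n hn => ?_)
      (add_left_injective l).injOn
    simp only [Finset.coe_filter, Finset.mem_Icc, Set.mem_ofPred_eq] at hn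
    simp only [S, Finset.coe_filter, Finset.mem_Icc, Set.mem_ofPred_eq]
    refine ⟨?_, hn.2⟩
    omega
  have hM0 : (0 : ℝ) < M := by
    have : 0 < M := by omega
    exact_mod_cast this
  have hRM : (R : ℝ) ≤ 2 * M := by
    have : R ≤ 2 * M := by omega
    exact_mod_cast this
  have hcard' : (k : ℝ) * S.card ≤ R := by exact_mod_cast hcard
  rw [dist_zero_right, Real.norm_of_nonneg
    (mul_nonneg (by positivity) (Finset.sum_nonneg fun _ _ => abs_nonneg _)), Int.card_Icc]
  have hk' : 2 < ε * k := by rwa [div_lt_iff₀ hε, mul_comm] at hk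
  have hkr : (0 : ℝ) < k := by exact_mod_cast hk0
  have : ((M : ℤ) + 1 - 1).toNat = M := by omega
  rw [this, inv_mul_lt_iff₀ hM0]
  refine hsum.trans_lt ?_
  by_contra! hcon
  nlinarith

end Construction

/-- A sequence of times along which the given sequences are very well separated. -/
lemma exists_separated {N : ℕ} (φ : Fin N → ℕ → ℤ)
    (hφ : ∀ a : Fin N → ℤ, a ≠ 0 → Tendsto (fun n => |∑ j, a j * φ j n|) atTop atTop) :
    ∃ (n : ℕ → ℕ) (L : ℕ → ℕ), StrictMono n ∧ Separated (fun k j => φ j (n k)) L := by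
  have hth : ∀ (k : ℕ) (G : ℤ), ∃ n₀, ∀ n ≥ n₀, ∀ b : Fin N → ℤ, b ≠ 0 →
      (∀ j, |b j| ≤ k + 1) → G ≤ |intComb (fun j => φ j n) b| := by
    intro k G
    have := (Filter.eventually_all_finset
      ((Fintype.piFinset fun _ : Fin N => Finset.Icc (-(k + 1 : ℤ)) (k + 1)).filter
        fun b => b ≠ 0)).2 fun b hb =>
      (hφ b (Finset.mem_filter.1 hb).2).eventually_ge_atTop G
    obtain ⟨n₀, hn₀⟩ := eventually_atTop.1 this
    refine ⟨n₀, fun n hn b hb hb' => hn₀ n hn b (Finset.mem_filter.2 ⟨?_, hb⟩)⟩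
    exact Fintype.mem_piFinset.2 fun j => Finset.mem_Icc.2 (_root_.abs_le.1 (hb' j))
  choose f hf using hth
  let thr : ℕ → ℕ → ℕ := fun k l => f k (3 * (l : ℤ) + 1 + k * cardBound N (k + 1))
  let nxt : ℕ → ℕ × ℕ → ℕ := fun k s =>
    s.2 + (k + 1) * ∑ j, (φ j s.1).natAbs + 1 + (k + 1) * cardBound N (k + 1)
  let st : ℕ → ℕ × ℕ := fun k => Nat.rec (thr 0 0, 0)
    (fun k s => (max (s.1 + 1) (thr (k + 1) (nxt k s)), nxt k s)) k
  have hthr : ∀ k, thr k (st k).2 ≤ (st k).1 := by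
    intro k
    cases k with
    | zero => exact le_rfl
    | succ k => exact le_max_right _ _
  have hsucc : ∀ k, (st (k + 1)).2 = nxt k (st k) := fun k => rfl
  refine ⟨fun k => (st k).1, fun k => (st k).2,
    strictMono_nat_of_lt_succ fun k => le_max_left ((st k).1 + 1) _, ?_, ?_, ?_⟩
  · intro k
    rw [hsucc]
    simp only [nxt]
    push_cast
    have : (0 : ℤ) ≤ (k + 1) * cardBound N (k + 1) := by positivity
    linarith
  · intro k
    cases k with
    | zero => simp
    | succ k =>
      rw [hsucc]
      simp only [nxt]
      omega
  · intro k b hb hb'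
    exact hf k _ _ (hthr k) b hb hb'
section Transfer

variable {X : Type*} [MeasurableSpace X] [StandardBorelSpace X]

open ProbabilityTheory in
lemma continuous_cdf_of_nullSingletonClass (ν : Measure ℝ) [IsProbabilityMeasure ν]
    [NullSingletonClass ν] :
    Continuous (cdf ν) := by
  rw [continuous_iff_continuousAt]
  intro x
  rw [(cdf ν).mono.continuousAt_iff_leftLim_eq_rightLim, StieltjesFunction.rightLim_eq]
  have h := (cdf ν).measure_singleton x
  rw [measure_cdf, measure_singleton, eq_comm, ENNReal.ofReal_eq_zero] at h
  exact le_antisymm ((cdf ν).mono.leftLim_le le_rfl) (by linarith)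

open ProbabilityTheory in
/-- The distribution function of an atomless probability measure is uniformly distributed. -/
lemma measure_cdf_le (ν : Measure ℝ) [IsProbabilityMeasure ν] [NullSingletonClass ν] {c : ℝ}
    (hc0 : 0 ≤ c) (hc1 : c ≤ 1) : ν {x | cdf ν x ≤ c} = ENNReal.ofReal c := by
  have hcont := continuous_cdf_of_nullSingletonClass ν
  rcases hc1.eq_or_lt with rfl | hc1
  · simp [cdf_le_one]
  set D := {x | cdf ν x ≤ c} with hD
  have hclosed : IsClosed D := isClosed_le hcont continuous_const
  rcases D.eq_empty_or_nonempty with hE | hne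
  · rcases hc0.eq_or_lt with rfl | hc0
    · simp [hE]
    · obtain ⟨x, hx⟩ := ((tendsto_cdf_atBot ν).eventually_le_const hc0).exists
      exact absurd (show x ∈ D from hx) (by simp [hE])
  obtain ⟨b, hb⟩ := ((tendsto_cdf_atTop ν).eventually_const_lt hc1).exists
  have hbdd : BddAbove D := ⟨b, fun x hx => by
    by_contra! h
    exact absurd ((cdf ν).mono h.le) (not_le.2 (lt_of_le_of_lt hx hb))⟩
  set s := sSup D
  have hs : s ∈ D := hclosed.csSup_mem hne hbdd
  have hDs : D = Set.Iic s := by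
    ext x
    exact ⟨fun hx => le_csSup hbdd hx, fun hx => ((cdf ν).mono hx).trans hs⟩
  have hsc : c ≤ cdf ν s := by
    have hev : ∀ᶠ y in 𝓝[>] s, c ≤ cdf ν y := by
      filter_upwards [self_mem_nhdsWithin] with y hy
      by_contra! h
      exact absurd (le_csSup hbdd (show y ∈ D from h.le)) (not_le.2 hy)
    exact ge_of_tendsto (hcont.continuousAt.mono_left nhdsWithin_le_nhds) hev
  rw [hDs, ← ofReal_cdf, le_antisymm hs hsc]

open ProbabilityTheory in
/-- An atomless standard Borel probability space maps onto `[0,1]`, injectively up to a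
null set. -/
lemma exists_measurePreserving_injOn (μ : Measure X) [IsProbabilityMeasure μ] [NullSingletonClass μ] :
    ∃ (j : X → unitInterval) (S : Set X), MeasurePreserving j μ volume ∧ MeasurableSet S ∧
      μ Sᶜ = 0 ∧ Set.InjOn j S := by
  set e := embeddingReal X
  have he := measurableEmbedding_embeddingReal X
  set ν := μ.map e
  have : IsProbabilityMeasure ν := Measure.isProbabilityMeasure_map he.measurable.aemeasurable
  have : NullSingletonClass ν := ⟨fun x => by
    rw [he.map_apply]
    exact (Set.subsingleton_singleton.preimage he.injective).measure_zero μ⟩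
  have hF : Measurable (cdf ν) := (cdf ν).mono.measurable
  let j₀ : ℝ → unitInterval := fun x => ⟨cdf ν x, cdf_nonneg ν x, cdf_le_one ν x⟩
  have hj₀ : Measurable j₀ := hF.subtype_mk
  have hmp : MeasurePreserving (j₀ ∘ e) μ volume := by
    refine ⟨hj₀.comp he.measurable, ?_⟩
    rw [← Measure.map_map hj₀ he.measurable]
    have : IsProbabilityMeasure (ν.map j₀) := Measure.isProbabilityMeasure_map hj₀.aemeasurable
    refine Measure.ext_of_Iic _ _ fun a => ?_
    rw [unitInterval.volume_Iic, Measure.map_apply hj₀ measurableSet_Iic]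
    exact measure_cdf_le ν a.2.1 a.2.2
  set B : Set X := ⋃ q : ℚ, (j₀ ∘ e) ⁻¹' {j₀ q}
  refine ⟨j₀ ∘ e, Bᶜ, hmp, ?_, ?_, ?_⟩
  · exact (MeasurableSet.iUnion fun q => hmp.measurable (measurableSet_singleton _)).compl
  · rw [compl_compl, measure_iUnion_null_iff]
    intro q
    rw [hmp.measure_preimage (measurableSet_singleton _).nullMeasurableSet]
    simp
  · have key : ∀ x ∈ Bᶜ, ∀ y, e x < e y → (j₀ ∘ e) x ≠ (j₀ ∘ e) y := by
      intro x hx y hxy h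
      obtain ⟨q, hq1, hq2⟩ := exists_rat_btwn hxy
      refine hx (Set.mem_iUnion.2 ⟨q, ?_⟩)
      have h' : cdf ν (e x) = cdf ν (e y) := congrArg Subtype.val h
      exact Subtype.ext (le_antisymm ((cdf ν).mono hq1.le)
        (((cdf ν).mono hq2.le).trans h'.ge))
    intro x hx y hy h
    by_contra hne
    rcases lt_or_gt_of_ne (he.injective.ne hne) with hlt | hlt
    · exact key x hx y hlt h
    · exact key y hy x hlt h.symm

/-- An automorphism of an atomless standard Borel probability space is isomorphic to an element of
`Aut01`; we record what this says about correlations. -/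
lemma exists_aut01_of_perm (μ : Measure X) [IsProbabilityMeasure μ] [NullSingletonClass μ]
    (T : Equiv.Perm X) (hT : MeasurePreserving T μ μ) (hT' : MeasurePreserving T.symm μ μ) :
    ∃ (T' : Aut01) (j : X → unitInterval), MeasurePreserving j μ volume ∧
      ∀ (m : ℤ) (A B : Set unitInterval), MeasurableSet A → MeasurableSet B →
        T'.corr m A B = μ.real (j ⁻¹' A ∩ ⇑(T ^ m) ⁻¹' (j ⁻¹' B)) := by
  classical
  obtain ⟨j, S, hj, hS, hS0, hinj⟩ := exists_measurePreserving_injOn μ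
  have hTm : ∀ m : ℤ, MeasurePreserving ⇑(T ^ m) μ μ := by
    intro m
    induction m using Int.induction_on with
    | zero => exact MeasurePreserving.id μ
    | succ n ih => rw [zpow_add_one]; exact ih.comp hT
    | pred n ih => rw [zpow_sub_one]; exact ih.comp hT'
  set S₁ : Set X := ⋂ m : ℤ, ⇑(T ^ m) ⁻¹' S with hS₁
  have hS₁m : MeasurableSet S₁ := MeasurableSet.iInter fun m => (hTm m).measurable hS
  have hS₁0 : μ S₁ᶜ = 0 := by
    rw [hS₁, Set.compl_iInter, measure_iUnion_null_iff]
    intro m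
    rw [← Set.preimage_compl, (hTm m).measure_preimage hS.compl.nullMeasurableSet, hS0]
  have hS₁S : S₁ ⊆ S := fun x hx => by simpa using Set.mem_iInter.1 hx 0
  have hinv : ∀ (m : ℤ) x, x ∈ S₁ → (T ^ m) x ∈ S₁ := by
    intro m x hx
    refine Set.mem_iInter.2 fun k => ?_
    have := Set.mem_iInter.1 hx (k + m)
    rwa [zpow_add] at this
  have hinv1 : ∀ x, T x ∈ S₁ ↔ x ∈ S₁ := fun x =>
    ⟨fun h => by simpa using hinv (-1) _ h, fun h => by simpa using hinv 1 _ h⟩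
  let e : S₁ ≃ j '' S₁ := Equiv.Set.imageOfInjOn j S₁ (hinj.mono hS₁S)
  let T₁ : Equiv.Perm S₁ := T.subtypePerm hinv1
  let R : Equiv.Perm unitInterval :=
    Equiv.Perm.ofSubtype (p := fun y => y ∈ j '' S₁) (e.permCongr T₁)
  have hpow : ∀ m : ℤ, R ^ m =
      Equiv.Perm.ofSubtype (p := fun y => y ∈ j '' S₁) (e.permCongr (T₁ ^ m)) := by
    intro m
    have : e.permCongr (T₁ ^ m) = (e.permCongr T₁) ^ m :=
      map_zpow (e.permCongrHom) T₁ m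
    rw [this, map_zpow]
  have hR : ∀ (m : ℤ) x, x ∈ S₁ → (R ^ m) (j x) = j ((T ^ m) x) := by
    intro m x hx
    have hT₁ : T₁ ^ m = (T ^ m).subtypePerm
        (fun x => ⟨fun h => by simpa using hinv (-m) _ h, fun h => hinv m _ h⟩) :=
      Equiv.Perm.subtypePerm_zpow ..
    rw [hpow, Equiv.Perm.ofSubtype_apply_of_mem _ ⟨x, hx, rfl⟩, Equiv.permCongr_apply]
    have hsymm : e.symm ⟨j x, x, hx, rfl⟩ = ⟨x, hx⟩ := by
      rw [Equiv.symm_apply_eq]; rfl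
    rw [hsymm, hT₁]
    rfl
  have hRoff : ∀ (m : ℤ) y, y ∉ j '' S₁ → (R ^ m) y = y := by
    intro m y hy
    rw [hpow]
    exact Equiv.Perm.ofSubtype_apply_of_not_mem _ hy
  have hYm : MeasurableSet (j '' S₁) :=
    hS₁m.image_of_measurable_injOn hj.measurable (hinj.mono hS₁S)
  have hRmeas : ∀ m : ℤ, Measurable ⇑(R ^ m) := by
    intro m B hB
    have : ⇑(R ^ m) ⁻¹' B =
        j '' (S₁ ∩ ⇑(T ^ m) ⁻¹' (j ⁻¹' B)) ∪ (B ∩ (j '' S₁)ᶜ) := by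
      ext y
      by_cases hy : y ∈ j '' S₁
      · obtain ⟨x, hx, rfl⟩ := hy
        simp only [Set.mem_preimage, hR m x hx, Set.mem_union, Set.mem_inter_iff,
          Set.mem_compl_iff, Set.mem_image_of_mem j hx, not_true, and_false, or_false]
        constructor
        · exact fun h => ⟨x, ⟨hx, h⟩, rfl⟩
        · rintro ⟨x', ⟨hx', h⟩, he⟩
          rwa [← hinj (hS₁S hx') (hS₁S hx) he]
      · simp only [Set.mem_preimage, hRoff m y hy, Set.mem_union, Set.mem_inter_iff,
          Set.mem_compl_iff, hy, not_false_eq_true, and_true]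
        exact ⟨Or.inr, fun h => h.resolve_left
          fun h => hy (Set.image_mono Set.inter_subset_left h)⟩
    rw [this]
    refine MeasurableSet.union ?_ (hB.inter hYm.compl)
    exact (hS₁m.inter ((hTm m).measurable (hj.measurable hB))).image_of_measurable_injOn
      hj.measurable ((hinj.mono hS₁S).mono Set.inter_subset_left)
  have hcorr : ∀ (m : ℤ) (A B : Set unitInterval), MeasurableSet A → MeasurableSet B →
      volume (A ∩ ⇑(R ^ m) ⁻¹' B) = μ (j ⁻¹' A ∩ ⇑(T ^ m) ⁻¹' (j ⁻¹' B)) := by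
    intro m A B hA hB
    rw [← hj.measure_preimage (hA.inter (hRmeas m hB)).nullMeasurableSet]
    refine measure_congr ?_
    filter_upwards [compl_mem_ae_iff.2 hS₁0] with x hx
    rw [compl_compl] at hx
    refine propext ?_
    change (j x ∈ A ∧ (R ^ m) (j x) ∈ B) ↔ (j x ∈ A ∧ j ((T ^ m) x) ∈ B)
    rw [hR m x hx]
  have hRmp : ∀ m : ℤ, MeasurePreserving ⇑(R ^ m) (volume : Measure unitInterval) volume := by
    intro m
    refine ⟨hRmeas m, Measure.ext fun B hB => ?_⟩
    rw [Measure.map_apply (hRmeas m) hB]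
    have := hcorr m Set.univ B MeasurableSet.univ hB
    rw [Set.univ_inter, Set.preimage_univ, Set.univ_inter,
      (hTm m).measure_preimage (hj.measurable hB).nullMeasurableSet,
      hj.measure_preimage hB.nullMeasurableSet] at this
    exact this
  refine ⟨⟨R, by simpa using hRmp 1, by simpa using hRmp (-1)⟩, j, hj, fun m A B hA hB => ?_⟩
  simp only [Aut01.corr, Measure.real]
  rw [hcorr m A B hA hB]

end Transfer
section Torus

instance : MeasurableSpace Circle := borel Circle

instance : BorelSpace Circle := ⟨rfl⟩

instance : SecondCountableTopology (ℤ → Circle) := inferInstance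

instance : TopologicalSpace.IsCompletelyMetrizableSpace (ℤ → Circle) := inferInstance

instance : PolishSpace (ℤ → Circle) where

/-- The character of `ℤ → Circle` with exponents `a`. -/
def torusChar (a : ℤ →₀ ℤ) : C(ℤ → Circle, ℂ) where
  toFun z := ((a.prod fun m k => z m ^ k : Circle) : ℂ)
  continuous_toFun := by
    simp only [Finsupp.prod]
    fun_prop

lemma torusChar_apply (a : ℤ →₀ ℤ) (z : ℤ → Circle) :
    torusChar a z = ((a.prod fun m k => z m ^ k : Circle) : ℂ) := rfl

@[simp] lemma torusChar_zero : torusChar 0 = 1 := by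
  ext z; simp [torusChar_apply]

lemma torusChar_add (a b : ℤ →₀ ℤ) : torusChar (a + b) = torusChar a * torusChar b := by
  ext z
  simp only [torusChar_apply, ContinuousMap.mul_apply]
  rw [Finsupp.prod_add_index' (by simp) (fun m => zpow_add (z m)), Circle.coe_mul]

lemma torusChar_neg (a : ℤ →₀ ℤ) : torusChar (-a) = star (torusChar a) := by
  ext z
  simp only [torusChar_apply, ContinuousMap.star_apply]
  rw [Finsupp.prod_neg_index (by simp), RCLike.star_def, ← Circle.coe_inv_eq_conj]
  simp [Finsupp.prod]

lemma torusChar_single (m : ℤ) (z : ℤ → Circle) : torusChar (Finsupp.single m 1) z = z m := by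
  simp [torusChar_apply]

/-- The star subalgebra of trigonometric polynomials. -/
def trigPoly : StarSubalgebra ℂ C(ℤ → Circle, ℂ) where
  toSubalgebra := Algebra.adjoin ℂ (Set.range torusChar)
  star_mem' := by
    change Algebra.adjoin ℂ (Set.range torusChar) ≤ star (Algebra.adjoin ℂ (Set.range torusChar))
    refine Algebra.adjoin_le ?_
    rintro - ⟨a, rfl⟩
    exact Algebra.subset_adjoin ⟨-a, torusChar_neg a⟩

lemma trigPoly_toSubmodule :
    Subalgebra.toSubmodule trigPoly.toSubalgebra = Submodule.span ℂ (Set.range torusChar) := by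
  refine Algebra.adjoin_eq_span_of_subset ℂ (Set.Subset.trans ?_ Submodule.subset_span)
  intro f hf
  refine Submonoid.closure_induction (fun _ => id) ⟨0, torusChar_zero⟩ ?_ hf
  rintro - - - - ⟨a, rfl⟩ ⟨b, rfl⟩
  exact ⟨a + b, torusChar_add a b⟩

lemma trigPoly_separatesPoints : trigPoly.SeparatesPoints := by
  intro z w hzw
  obtain ⟨m, hm⟩ := Function.ne_iff.1 hzw
  refine ⟨_, ⟨torusChar (Finsupp.single m 1), Algebra.subset_adjoin ⟨_, rfl⟩, rfl⟩, ?_⟩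
  simp only [torusChar_single]
  exact fun h => hm (Circle.ext h)

lemma span_torusChar_topologicalClosure :
    (Submodule.span ℂ (Set.range torusChar)).topologicalClosure = ⊤ := by
  rw [← trigPoly_toSubmodule]
  exact congr_arg (Subalgebra.toSubmodule <| StarSubalgebra.toSubalgebra ·)
    (ContinuousMap.starSubalgebra_topologicalClosure_eq_top_of_separatesPoints trigPoly
      trigPoly_separatesPoints)

/-- Finite measures on `ℤ → Circle` are determined by the integrals of the characters. -/
lemma measure_ext_of_torusChar {μ ν : Measure (ℤ → Circle)} [IsFiniteMeasure μ]
    [IsFiniteMeasure ν] (h : ∀ a, ∫ z, torusChar a z ∂μ = ∫ z, torusChar a z ∂ν) : μ = ν := by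
  refine ext_of_forall_mem_subalgebra_integral_eq_of_polish
    (A := trigPoly.comap (BoundedContinuousFunction.toContinuousMapStarₐ ℂ)) ?_ ?_
  · intro z w hzw
    obtain ⟨_, ⟨f, hf, rfl⟩, hfzw⟩ := trigPoly_separatesPoints hzw
    exact ⟨_, ⟨f, ⟨BoundedContinuousFunction.mkOfCompact f, hf, rfl⟩, rfl⟩, hfzw⟩
  · intro g hg
    have hint : ∀ (f : C(ℤ → Circle, ℂ)) (P : Measure (ℤ → Circle)) [IsFiniteMeasure P],
        Integrable f P := fun f P _ => f.continuous.integrable_of_hasCompactSupport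
          (HasCompactSupport.of_compactSpace _)
    have hspan : ∀ f ∈ Submodule.span ℂ (Set.range torusChar),
        ∫ z, f z ∂μ = ∫ z, f z ∂ν := by
      intro f hf
      induction hf using Submodule.span_induction with
      | mem f hf => obtain ⟨a, rfl⟩ := hf; exact h a
      | zero => simp
      | add f g _ _ hf hg =>
        simp only [ContinuousMap.add_apply]
        rw [integral_add (hint f μ) (hint g μ), integral_add (hint f ν) (hint g ν), hf, hg]
      | smul c f _ hf =>
        simp only [ContinuousMap.smul_apply]
        rw [integral_smul, integral_smul, hf]
    rw [← trigPoly_toSubmodule] at hspan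
    exact hspan _ hg

lemma span_torusChar_Lp (μ : Measure (ℤ → Circle)) [IsFiniteMeasure μ] :
    (Submodule.span ℂ (Set.range fun a =>
      ContinuousMap.toLp 2 μ ℂ (torusChar a))).topologicalClosure = ⊤ := by
  have h := (ContinuousMap.toLp_denseRange ℂ μ ℂ (p := 2)
    (by simp)).topologicalClosure_map_submodule
    span_torusChar_topologicalClosure
  rwa [Submodule.map_span, ← Set.range_comp] at h

end Torus

section Gaussian

/-- The bilinear form on finitely supported integer sequences with kernel `r (m - l)`. -/
def covForm (r : ℤ → ℝ) : (ℤ →₀ ℤ) →ₗ[ℤ] (ℤ →₀ ℤ) →ₗ[ℤ] ℝ :=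
  Finsupp.linearCombination ℤ fun m => Finsupp.linearCombination ℤ fun l => r (m - l)

lemma covForm_apply (r : ℤ → ℝ) (a b : ℤ →₀ ℤ) :
    covForm r a b = ∑ m ∈ a.support, ∑ l ∈ b.support, (a m : ℝ) * b l * r (m - l) := by
  simp [covForm, Finsupp.linearCombination_apply, Finsupp.sum, Finset.mul_sum, mul_assoc]

lemma covForm_mapDomain (r : ℤ → ℝ) (n : ℤ) (a b : ℤ →₀ ℤ) :
    covForm r (a.mapDomain (· + n)) b = covForm (fun m => r (m + n)) a b := by
  rw [covForm, Finsupp.linearCombination_mapDomain, covForm]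
  congr! 5
  simp only [Function.comp]
  congr! 3
  ring

lemma covForm_comm {r : ℤ → ℝ} (hr : ∀ m, r (-m) = r m) (a b : ℤ →₀ ℤ) :
    covForm r a b = covForm r b a := by
  rw [covForm_apply, covForm_apply, Finset.sum_comm]
  refine Finset.sum_congr rfl fun l _ => Finset.sum_congr rfl fun m _ => ?_
  rw [← hr, neg_sub, mul_comm (a m : ℝ)]

lemma covForm_mapDomain_right (r : ℤ → ℝ) (n : ℤ) (a b : ℤ →₀ ℤ) :
    covForm r a (b.mapDomain (· + n)) = covForm (fun m => r (m - n)) a b := by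
  simp only [covForm]
  rw [Finsupp.linearCombination_apply, Finsupp.linearCombination_apply]
  simp only [Finsupp.sum, LinearMap.sum_apply, LinearMap.smul_apply,
    Finsupp.linearCombination_mapDomain]
  refine Finset.sum_congr rfl fun m _ => ?_
  congr 3
  funext l
  simp only [Function.comp_apply]
  congr 1
  ring

lemma covForm_mapDomain_self (r : ℤ → ℝ) (n : ℤ) (a b : ℤ →₀ ℤ) :
    covForm r (a.mapDomain (· + n)) (b.mapDomain (· + n)) = covForm r a b := by
  simp [covForm_mapDomain, covForm_mapDomain_right]

/-- The finite-dimensional Gaussian approximation. -/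
lemma exists_measure_of_support_subset {r : ℤ → ℝ} (hr : PosDefSeq r) (I : Finset ℤ) :
    ∃ μ : Measure (ℤ → Circle), IsProbabilityMeasure μ ∧ ∀ a : ℤ →₀ ℤ, a.support ⊆ I →
      ∫ z, torusChar a z ∂μ = Real.exp (-(covForm r a a) / 2) := by
  classical
  let S : Matrix I I ℝ := Matrix.of fun i j => r (i - j)
  have hS : S.PosSemidef := by
    refine Matrix.PosSemidef.of_dotProduct_mulVec_nonneg ?_ fun x => ?_
    · ext i j
      simp [S, ← hr.even ((i : ℤ) - j)]
    · have := hr.nonneg_sum I (fun i => i) x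
      simpa [S, dotProduct, Matrix.mulVec, Finset.mul_sum, mul_assoc, mul_comm,
        mul_left_comm] using this
  let p : EuclideanSpace ℝ I → ℤ → Circle := fun x m =>
    if hm : m ∈ I then Circle.exp (x ⟨m, hm⟩) else 1
  have hp : Continuous p := by
    refine continuous_pi fun m => ?_
    simp only [p]
    split_ifs <;> fun_prop
  refine ⟨(ProbabilityTheory.multivariateGaussian 0 S).map p,
    Measure.isProbabilityMeasure_map hp.aemeasurable, fun a ha => ?_⟩
  rw [integral_map hp.aemeasurable (torusChar a).continuous.aestronglyMeasurable]
  let v : EuclideanSpace ℝ I := WithLp.toLp 2 fun i => (a i : ℝ)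
  have h := ProbabilityTheory.charFun_multivariateGaussian (μ := 0) hS v
  rw [charFun_apply] at h
  have hsum : ∀ f : ℤ → ℝ, ∑ m ∈ a.support, (a m : ℝ) * f m = ∑ i : I, (a i : ℝ) * f i := by
    intro f
    rw [Finset.sum_coe_sort I fun m => (a m : ℝ) * f m]
    exact Finset.sum_subset ha fun m _ hm => by simp [Finsupp.notMem_support_iff.1 hm]
  convert h using 1
  · refine integral_congr_ae (.of_forall fun x => ?_)
    have h1 : (a.prod fun m k => p x m ^ k) = Circle.exp (inner ℝ x v) := by
      have h3 : inner ℝ x v = ∑ m ∈ a.support, (a m : ℝ) * if hm : m ∈ I then x ⟨m, hm⟩ else 0 := by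
        rw [hsum]
        simp [v, PiLp.inner_apply]
      have h4 : ∀ (s : Finset ℤ) (g : ℤ → ℝ),
          Circle.exp (∑ m ∈ s, g m) = ∏ m ∈ s, Circle.exp (g m) := fun s g => by
        induction s using Finset.induction_on with
        | empty => simp
        | insert m s hm ih => rw [Finset.sum_insert hm, Finset.prod_insert hm, Circle.exp_add, ih]
      rw [h3, h4]
      refine Finset.prod_congr rfl fun m _ => ?_
      simp only [p, Circle.exp_intCast_mul]
      split_ifs <;> simp
    simp only [torusChar_apply, h1, Circle.coe_exp]
  · have h2 : covForm r a a = v ⬝ᵥ S.mulVec v := by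
      simp only [covForm_apply, mul_assoc, ← Finset.mul_sum]
      rw [hsum fun m => ∑ l ∈ a.support, (a l : ℝ) * r (m - l)]
      simp only [hsum fun l => r (_ - l), dotProduct, Matrix.mulVec]
      simp [v, S, mul_comm]
    rw [h2, inner_zero_right]
    push_cast
    congr 1
    simp [neg_div]

lemma exists_torus_measure {r : ℤ → ℝ} (hr : PosDefSeq r) :
    ∃ μ : Measure (ℤ → Circle), IsProbabilityMeasure μ ∧ ∀ a : ℤ →₀ ℤ,
      ∫ z, torusChar a z ∂μ = Real.exp (-(covForm r a a) / 2) := by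
  choose ν hν using fun K : ℕ => exists_measure_of_support_subset hr (Finset.Icc (-(K : ℤ)) K)
  let ν' : ℕ → ProbabilityMeasure (ℤ → Circle) := fun K => ⟨ν K, (hν K).1⟩
  obtain ⟨μ, -, hμ⟩ := isCompact_univ.ultrafilter_le_nhds
    ((hyperfilter ℕ : Ultrafilter ℕ).map ν') (by simp)
  refine ⟨μ, inferInstance, fun a => ?_⟩
  have hre := (ProbabilityMeasure.tendsto_iff_forall_integral_rclike_tendsto ℂ).1
    (show Tendsto ν' (hyperfilter ℕ) (𝓝 μ) from hμ)
    (BoundedContinuousFunction.mkOfCompact (torusChar a))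
  refine tendsto_nhds_unique hre (tendsto_const_nhds.congr' ?_)
  have : ∀ᶠ K : ℕ in (hyperfilter ℕ : Filter ℕ), a.support ⊆ Finset.Icc (-(K : ℤ)) K := by
    refine Filter.Eventually.filter_mono Nat.hyperfilter_le_atTop ?_
    filter_upwards [eventually_ge_atTop (∑ m ∈ a.support, m.natAbs)] with K hK m hm
    have h1 : m.natAbs ≤ ∑ m ∈ a.support, m.natAbs :=
      Finset.single_le_sum (f := fun m : ℤ => m.natAbs) (fun _ _ => Nat.zero_le _) hm
    rw [Finset.mem_Icc]
    omega
  filter_upwards [this] with K hK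
  exact ((hν K).2 a hK).symm

end Gaussian

section AvgNull

variable {κ : Type*} {s : κ → Finset ℤ} {F : Filter κ} {u v : ℤ → ℝ}

lemma AvgNull.of_forall_le (h : ∀ ε > 0, ∃ v, AvgNull s F v ∧ ∀ n, |u n| ≤ |v n| + ε) :
    AvgNull s F u := by
  refine Metric.tendsto_nhds.2 fun ε hε => ?_
  obtain ⟨v, hv, huv⟩ := h (ε / 2) (half_pos hε)
  filter_upwards [Metric.tendsto_nhds.1 hv (ε / 2) (half_pos hε)] with k hk
  have hnn : ∀ w : ℤ → ℝ, 0 ≤ ((s k).card : ℝ)⁻¹ * ∑ n ∈ s k, |w n| := fun w =>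
    mul_nonneg (by positivity) (Finset.sum_nonneg fun _ _ => abs_nonneg _)
  rw [dist_zero_right, Real.norm_of_nonneg (hnn _)] at hk ⊢
  have h1 : ((s k).card : ℝ)⁻¹ * ∑ n ∈ s k, |u n| ≤
      ((s k).card : ℝ)⁻¹ * ∑ n ∈ s k, (|v n| + ε / 2) :=
    mul_le_mul_of_nonneg_left (Finset.sum_le_sum fun n _ => huv n) (by positivity)
  rw [Finset.sum_add_distrib, Finset.sum_const, nsmul_eq_mul, mul_add, ← mul_assoc] at h1
  have h2 : ((s k).card : ℝ)⁻¹ * (s k).card ≤ 1 := inv_mul_le_one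
  nlinarith

lemma AvgNull.mono (hv : AvgNull s F v) (h : ∀ n, |u n| ≤ |v n|) : AvgNull s F u :=
  .of_forall_le fun _ hε => ⟨v, hv, fun n => (h n).trans (le_add_of_nonneg_right hε.le)⟩

lemma AvgNull.zero : AvgNull s F fun _ => 0 := by simp [AvgNull, tendsto_const_nhds]

lemma AvgNull.const_mul (c : ℝ) (hu : AvgNull s F u) : AvgNull s F fun n => c * u n := by
  have := Tendsto.const_mul |c| hu
  rw [mul_zero] at this
  refine this.congr fun k => ?_
  simp only [abs_mul, ← Finset.mul_sum]
  ring

lemma AvgNull.add (hu : AvgNull s F u) (hv : AvgNull s F v) : AvgNull s F fun n => u n + v n := by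
  have h : AvgNull s F fun n => |u n| + |v n| := by
    have := Tendsto.add hu hv
    rw [add_zero] at this
    refine this.congr fun k => ?_
    rw [← mul_add, ← Finset.sum_add_distrib]
    congr 1
    exact Finset.sum_congr rfl fun n _ => (abs_of_nonneg (by positivity)).symm
  exact h.mono fun n => (abs_add_le _ _).trans (le_abs_self _)

lemma AvgNull.sum {ι : Type*} (I : Finset ι) {u : ι → ℤ → ℝ} (hu : ∀ i ∈ I, AvgNull s F (u i)) :
    AvgNull s F fun n => ∑ i ∈ I, u i n := by
  classical
  induction I using Finset.induction_on with
  | empty => simpa using AvgNull.zero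
  | insert i I hi ih =>
    simp only [Finset.sum_insert hi]
    exact (hu i (Finset.mem_insert_self i I)).add
      (ih fun j hj => hu j (Finset.mem_insert_of_mem hj))

/-- A sequence of equibounded seminorms which is null in mean on a set with dense span is
null in mean. -/
lemma avgNull_seminorm {H : Type*} [NormedAddCommGroup H] [NormedSpace ℂ H] {S : Set H}
    (hS : (Submodule.span ℂ S).topologicalClosure = ⊤) (p : ℤ → Seminorm ℂ H) {C : ℝ}
    (hC : ∀ n x, p n x ≤ C * ‖x‖) (h : ∀ x ∈ S, AvgNull s F fun n => p n x) (x : H) :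
    AvgNull s F fun n => p n x := by
  have hspan : ∀ y ∈ Submodule.span ℂ S, AvgNull s F fun n => p n y := by
    intro y hy
    induction hy using Submodule.span_induction with
    | mem y hy => exact h y hy
    | zero => simpa using AvgNull.zero
    | add y z _ _ hy hz =>
      refine (hy.add hz).mono fun n => ?_
      rw [abs_of_nonneg (apply_nonneg _ _), abs_of_nonneg (add_nonneg (apply_nonneg _ _)
        (apply_nonneg _ _))]
      exact map_add_le_add _ _ _
    | smul c y _ hy => simpa [map_smul_eq_mul] using hy.const_mul ‖c‖
  refine .of_forall_le fun ε hε => ?_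
  have hx : x ∈ closure (Submodule.span ℂ S : Set H) := by
    rw [← Submodule.topologicalClosure_coe, hS]; trivial
  obtain ⟨y, hy, hxy⟩ := Metric.mem_closure_iff.1 hx (ε / (|C| + 1)) (by positivity)
  refine ⟨_, hspan y hy, fun n => ?_⟩
  rw [abs_of_nonneg (apply_nonneg _ _), abs_of_nonneg (apply_nonneg _ _)]
  have h1 : p n x ≤ p n y + p n (x - y) := by
    simpa using map_add_le_add (p n) y (x - y)
  have h2 : C * ‖x - y‖ ≤ ε := by
    rw [dist_eq_norm, lt_div_iff₀ (by positivity)] at hxy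
    nlinarith [le_abs_self C, norm_nonneg (x - y)]
  linarith [hC n (x - y)]

lemma avgNull_inner {H : Type*} [NormedAddCommGroup H] [InnerProductSpace ℂ H] {S : Set H}
    (hS : (Submodule.span ℂ S).topologicalClosure = ⊤) (W : ℤ → H →L[ℂ] H) {C : ℝ}
    (hC : ∀ n, ‖W n‖ ≤ C) (h : ∀ f ∈ S, ∀ g ∈ S, AvgNull s F fun n => ‖inner ℂ f (W n g)‖)
    (f g : H) : AvgNull s F fun n => ‖inner ℂ f (W n g)‖ := by
  have hbound : ∀ n (f g : H), ‖inner ℂ f (W n g)‖ ≤ ‖f‖ * (C * ‖g‖) := fun n f g =>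
    (norm_inner_le_norm _ _).trans (mul_le_mul_of_nonneg_left
      ((W n).le_of_opNorm_le (hC n) g) (norm_nonneg _))
  have h1 : ∀ f ∈ S, AvgNull s F fun n => ‖inner ℂ f (W n g)‖ := fun f hf =>
    avgNull_seminorm hS
      (fun n => (normSeminorm ℂ ℂ).comp ((innerSL ℂ f).comp (W n)).toLinearMap)
      (C := ‖f‖ * C) (fun n x => (hbound n f x).trans_eq (by ring)) (h f hf) g
  refine (avgNull_seminorm hS
    (fun n => (normSeminorm ℂ ℂ).comp (innerSL ℂ (W n g)).toLinearMap)
    (C := C * ‖g‖) (fun n x => ?_) (fun x hx => ?_) f).mono fun n => ?_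
  · exact (norm_inner_symm _ _).trans_le ((hbound n x g).trans_eq (by ring))
  · exact (h1 x hx).mono fun n => by simp [norm_inner_symm (W n g)]
  · simp [norm_inner_symm (W n g)]

lemma AvgNull.exp_sub_exp {M t : ℝ} (hu : AvgNull s F fun n => u n - t) (huM : ∀ n, u n ≤ M)
    (htM : t ≤ M) : AvgNull s F fun n => Real.exp (u n) - Real.exp t := by
  refine (hu.const_mul (Real.exp M)).mono fun n => ?_
  have key : ∀ a b, a ≤ b → b ≤ M → Real.exp b - Real.exp a ≤ Real.exp M * (b - a) := by
    intro a b hab hb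
    have h1 := Real.add_one_le_exp (a - b)
    have h2 : Real.exp a = Real.exp b * Real.exp (a - b) := by rw [← Real.exp_add]; ring_nf
    have h3 := Real.exp_le_exp.2 hb
    nlinarith [Real.exp_pos b]
  rw [abs_mul, abs_of_pos (Real.exp_pos M)]
  rcases le_total (u n) t with h | h
  · rw [abs_of_nonpos (sub_nonpos.2 (Real.exp_le_exp.2 h)), abs_of_nonpos (sub_nonpos.2 h)]
    linarith [key _ _ h htM]
  · rw [abs_of_nonneg (sub_nonneg.2 (Real.exp_le_exp.2 h)), abs_of_nonneg (sub_nonneg.2 h)]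
    exact key _ _ h (huM n)

end AvgNull

section Shift

/-- The shift on `ℤ → Circle`. -/
def torusShift : Equiv.Perm (ℤ → Circle) where
  toFun z i := z (i + 1)
  invFun z i := z (i - 1)
  left_inv z := by ext; simp
  right_inv z := by ext; simp

lemma torusShift_zpow_apply (n : ℤ) (z : ℤ → Circle) (i : ℤ) :
    (torusShift ^ n) z i = z (i + n) := by
  induction n generalizing z with
  | zero => simp
  | succ n ih =>
    rw [zpow_add_one, Equiv.Perm.mul_apply, ih]
    exact congrArg z (by ring)
  | pred n ih =>
    rw [zpow_sub_one, Equiv.Perm.mul_apply, ih]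
    exact congrArg z (by ring)

lemma continuous_torusShift_zpow (n : ℤ) : Continuous ⇑(torusShift ^ n) := by
  refine continuous_pi fun i => ?_
  simp only [torusShift_zpow_apply]
  fun_prop

lemma torusChar_torusShift_zpow (a : ℤ →₀ ℤ) (n : ℤ) (z : ℤ → Circle) :
    torusChar a ((torusShift ^ n) z) = torusChar (a.mapDomain (· + n)) z := by
  simp only [torusChar_apply]
  rw [Finsupp.prod_mapDomain_index_inj (add_left_injective n)]
  simp [torusShift_zpow_apply]

variable {r : ℤ → ℝ} {μ : Measure (ℤ → Circle)} [IsProbabilityMeasure μ]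

lemma measurePreserving_torusShift_zpow
    (hμ : ∀ a, ∫ z, torusChar a z ∂μ = Real.exp (-(covForm r a a) / 2)) (n : ℤ) :
    MeasurePreserving ⇑(torusShift ^ n) μ μ := by
  have hm := (continuous_torusShift_zpow n).measurable
  refine ⟨hm, ?_⟩
  have := Measure.isProbabilityMeasure_map (μ := μ) hm.aemeasurable
  refine measure_ext_of_torusChar fun a => ?_
  rw [integral_map hm.aemeasurable (torusChar a).continuous.aestronglyMeasurable]
  simp only [torusChar_torusShift_zpow, hμ, covForm_mapDomain_self]

lemma inner_torusChar (hr : ∀ m, r (-m) = r m)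
    (hμ : ∀ a, ∫ z, torusChar a z ∂μ = Real.exp (-(covForm r a a) / 2)) (a b : ℤ →₀ ℤ) :
    inner ℂ (ContinuousMap.toLp 2 μ ℂ (torusChar a)) (ContinuousMap.toLp 2 μ ℂ (torusChar b)) =
      Real.exp (-(covForm r a a + covForm r b b) / 2 + covForm r b a) := by
  rw [ContinuousMap.inner_toLp]
  have : ∀ z, torusChar b z * (starRingEnd ℂ) (torusChar a z) = torusChar (b - a) z := fun z => by
    rw [sub_eq_add_neg, torusChar_add, torusChar_neg]; rfl
  simp only [this, hμ]
  congr 2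
  simp only [map_sub, LinearMap.sub_apply, covForm_comm hr a b]
  ring

lemma inner_indicator {A B : Set (ℤ → Circle)} (hA : MeasurableSet A) (hB : MeasurableSet B) :
    inner ℂ (indicatorConstLp 2 hA (measure_ne_top μ A) (1 : ℂ))
      (indicatorConstLp 2 hB (measure_ne_top μ B) (1 : ℂ)) = (μ.real (A ∩ B) : ℂ) :=
  L2.inner_indicatorConstLp_one_indicatorConstLp_one hA hB

lemma toLp_torusChar_zero :
    ContinuousMap.toLp 2 μ ℂ (torusChar 0) =
      indicatorConstLp 2 .univ (measure_ne_top μ Set.univ) (1 : ℂ) := by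
  refine Lp.ext ((ContinuousMap.coeFn_toLp μ _).trans ?_)
  refine .trans (.of_forall fun z => ?_) indicatorConstLp_coeFn.symm
  simp

variable (hμ : ∀ a, ∫ z, torusChar a z ∂μ = Real.exp (-(covForm r a a) / 2))

/-- The Koopman operators of the shift. -/
def koopman (n : ℤ) : Lp ℂ 2 μ →L[ℂ] Lp ℂ 2 μ :=
  (Lp.compMeasurePreservingₗᵢ ℂ _ (measurePreserving_torusShift_zpow hμ n)).toContinuousLinearMap

lemma koopman_torusChar (n : ℤ) (a : ℤ →₀ ℤ) :
    koopman hμ n (ContinuousMap.toLp 2 μ ℂ (torusChar a)) =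
      ContinuousMap.toLp 2 μ ℂ (torusChar (a.mapDomain (· + n))) := by
  have hT := measurePreserving_torusShift_zpow hμ n
  refine Lp.ext ((Lp.coeFn_compMeasurePreserving _ hT).trans ?_)
  refine (hT.quasiMeasurePreserving.ae_eq_comp (ContinuousMap.coeFn_toLp μ (torusChar a))).trans ?_
  refine .trans (.of_forall fun z => ?_) (ContinuousMap.coeFn_toLp μ _).symm
  exact torusChar_torusShift_zpow a n z

lemma avgNull_inner_koopman_sub {κ : Type*} {s : κ → Finset ℤ} {F : Filter κ}
    (hr : ∀ m, r (-m) = r m) (hr1 : ∀ m, |r m| ≤ 1) {ρ : ℤ → ℝ} (hρ1 : ∀ m, |ρ m| ≤ 1)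
    (hρ : ∀ l, AvgNull s F fun n => r (n + l) - ρ l) (V : Lp ℂ 2 μ →L[ℂ] Lp ℂ 2 μ)
    (hV : ∀ a b, inner ℂ (ContinuousMap.toLp 2 μ ℂ (torusChar a))
      (V (ContinuousMap.toLp 2 μ ℂ (torusChar b))) =
        Real.exp (-(covForm r a a + covForm r b b) / 2 + covForm ρ b a)) (f g : Lp ℂ 2 μ) :
    AvgNull s F fun n => ‖inner ℂ f ((koopman hμ n - V) g)‖ := by
  refine avgNull_inner (span_torusChar_Lp μ) (fun n => koopman hμ n - V) (C := 1 + ‖V‖)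
    (fun n => ?_) ?_ f g
  · exact (norm_sub_le _ _).trans
      (add_le_add_left (LinearIsometry.norm_toContinuousLinearMap_le _) _)
  rintro - ⟨a, rfl⟩ - ⟨b, rfl⟩
  have hbound : ∀ v : ℤ → ℝ, (∀ m, |v m| ≤ 1) → covForm v b a ≤
      ∑ m ∈ b.support, ∑ l ∈ a.support, |(b m : ℝ) * a l| := by
    intro v hv
    rw [covForm_apply]
    refine Finset.sum_le_sum fun m _ => Finset.sum_le_sum fun l _ => (le_abs_self _).trans ?_
    rw [abs_mul]
    exact mul_le_of_le_one_right (abs_nonneg _) (hv _)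
  have hdiff : AvgNull s F fun n => covForm (fun m => r (m + n)) b a - covForm ρ b a := by
    simp only [covForm_apply, ← Finset.sum_sub_distrib, ← mul_sub]
    refine .sum _ fun m _ => .sum _ fun l _ => .const_mul _ ?_
    simpa only [add_comm] using hρ (m - l)
  have hexp := AvgNull.exp_sub_exp
    (u := fun n => -(covForm r a a + covForm r b b) / 2 + covForm (fun m => r (m + n)) b a)
    (by simpa only [add_sub_add_left_eq_sub] using hdiff)
    (fun n => add_le_add_right (hbound _ fun m => hr1 _) _) (add_le_add_right (hbound ρ hρ1) _)
  refine hexp.mono fun n => le_of_eq ?_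
  rw [sub_apply, inner_sub_right, hV, koopman_torusChar,
    inner_torusChar hr hμ, covForm_mapDomain_self, covForm_mapDomain, abs_norm,
    ← Complex.ofReal_sub, Complex.norm_real, Real.norm_eq_abs]

lemma inner_indicator_koopman (n : ℤ) {A B : Set (ℤ → Circle)} (hA : MeasurableSet A)
    (hB : MeasurableSet B) :
    inner ℂ (indicatorConstLp 2 hA (measure_ne_top μ A) (1 : ℂ))
      (koopman hμ n (indicatorConstLp 2 hB (measure_ne_top μ B) (1 : ℂ))) =
        (μ.real (A ∩ ⇑(torusShift ^ n) ⁻¹' B) : ℂ) :=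
  inner_indicator hA (hB.preimage (continuous_torusShift_zpow n).measurable)

/-- Rigidity in mean of the shift. -/
lemma avgNull_corr_rigid {κ : Type*} {s : κ → Finset ℤ} {F : Filter κ}
    (hμ : ∀ a, ∫ z, torusChar a z ∂μ = Real.exp (-(covForm r a a) / 2))
    (hr : ∀ m, r (-m) = r m) (hr1 : ∀ m, |r m| ≤ 1)
    (h : ∀ l, AvgNull s F fun n => r (n + l) - r l) {A B : Set (ℤ → Circle)}
    (hA : MeasurableSet A) (hB : MeasurableSet B) :
    AvgNull s F fun n => μ.real (A ∩ ⇑(torusShift ^ n) ⁻¹' B) - μ.real (A ∩ B) := by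
  refine (avgNull_inner_koopman_sub hμ hr hr1 hr1 h (.id ℂ _) (inner_torusChar hr hμ)
    (indicatorConstLp 2 hA (measure_ne_top μ A) 1)
    (indicatorConstLp 2 hB (measure_ne_top μ B) 1)).mono fun n => le_of_eq ?_
  rw [sub_apply, inner_sub_right, inner_indicator_koopman,
    ContinuousLinearMap.id_apply, inner_indicator, abs_norm, ← Complex.ofReal_sub,
    Complex.norm_real, Real.norm_eq_abs]

/-- Mixing in mean of the shift. -/
lemma avgNull_corr_mixing {κ : Type*} {s : κ → Finset ℤ} {F : Filter κ}
    (hμ : ∀ a, ∫ z, torusChar a z ∂μ = Real.exp (-(covForm r a a) / 2))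
    (hr : ∀ m, r (-m) = r m) (hr1 : ∀ m, |r m| ≤ 1)
    (h : ∀ l, AvgNull s F fun n => r (n + l)) {A B : Set (ℤ → Circle)}
    (hA : MeasurableSet A) (hB : MeasurableSet B) :
    AvgNull s F fun n => μ.real (A ∩ ⇑(torusShift ^ n) ⁻¹' B) - μ.real A * μ.real B := by
  let e : Lp ℂ 2 μ := ContinuousMap.toLp 2 μ ℂ (torusChar 0)
  have he : ∀ {A : Set (ℤ → Circle)} (hA : MeasurableSet A),
      inner ℂ e (indicatorConstLp 2 hA (measure_ne_top μ A) (1 : ℂ)) = μ.real A := by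
    intro A hA
    simp only [e, toLp_torusChar_zero]
    rw [inner_indicator, Set.univ_inter]
  refine (avgNull_inner_koopman_sub hμ hr hr1 (ρ := 0) (by simp) (by simpa using h)
    ((innerSL ℂ e).smulRight e) (fun a b => ?_)
    (indicatorConstLp 2 hA (measure_ne_top μ A) 1)
    (indicatorConstLp 2 hB (measure_ne_top μ B) 1)).mono fun n => le_of_eq ?_
  · rw [ContinuousLinearMap.smulRight_apply, innerSL_apply_apply, inner_smul_right,
      inner_torusChar hr hμ, inner_torusChar hr hμ, ← Complex.ofReal_mul, ← Real.exp_add]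
    congr 2
    simp [covForm_apply]
    ring
  · rw [sub_apply, inner_sub_right, inner_indicator_koopman,
      ContinuousLinearMap.smulRight_apply, innerSL_apply_apply, inner_smul_right, he,
      ← inner_conj_symm, he, abs_norm, Complex.conj_ofReal, ← Complex.ofReal_mul,
      ← Complex.ofReal_sub, Complex.norm_real, Real.norm_eq_abs, mul_comm (μ.real B)]

end Shift

section Assembly

lemma AvgNull.le_zero_of_le {u : ℤ → ℝ}
    (hu : AvgNull (fun M : ℕ => Finset.Icc (1 : ℤ) M) atTop u) {δ : ℝ} (h : ∀ n, δ ≤ |u n|) :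
    δ ≤ 0 := by
  refine ge_of_tendsto hu ?_
  filter_upwards [eventually_gt_atTop 0] with M hM
  have hcard : (0 : ℝ) < (Finset.Icc (1 : ℤ) M).card := by simpa using hM
  rw [le_inv_mul_iff₀ hcard, ← nsmul_eq_mul]
  exact Finset.card_nsmul_le_sum _ _ _ fun n _ => h n

lemma avgNull_singleton_iff {x : ℕ → ℤ} {u : ℤ → ℝ} :
    AvgNull (fun k => {x k}) atTop u ↔ Tendsto (fun k => u (x k)) atTop (𝓝 0) := by
  simp [AvgNull, tendsto_zero_iff_abs_tendsto_zero, Function.comp_def]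

variable {r : ℤ → ℝ} {μ : Measure (ℤ → Circle)} [IsProbabilityMeasure μ]

lemma measure_singleton_eq_zero
    (hμ : ∀ a, ∫ z, torusChar a z ∂μ = Real.exp (-(covForm r a a) / 2))
    (hr : ∀ m, r (-m) = r m) (hr1 : ∀ m, |r m| ≤ 1) (hr0 : r 0 = 1)
    (h : ∀ l, AvgNull (fun M : ℕ => Finset.Icc (1 : ℤ) M) atTop fun n => r (n + l))
    (x : ℤ → Circle) : μ {x} = 0 := by
  by_contra hx
  set p := μ.real {x}
  have hp : 0 < p := ENNReal.toReal_pos hx (measure_ne_top _ _)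
  have hδ := (avgNull_corr_mixing hμ hr hr1 h (measurableSet_singleton x)
    (measurableSet_singleton x)).le_zero_of_le (δ := min (p * p) (p - p * p)) fun n => by
      have hor : ({x} ∩ ⇑(torusShift ^ n) ⁻¹' {x} : Set (ℤ → Circle)) = {x} ∨
          ({x} ∩ ⇑(torusShift ^ n) ⁻¹' {x} : Set (ℤ → Circle)) = ∅ :=
        Set.subset_singleton_iff_eq.1 Set.inter_subset_left |>.symm
      rcases hor with hor | hor <;> rw [hor]
      · exact (min_le_right _ _).trans (le_abs_self _)
      · rw [measureReal_empty, zero_sub, abs_neg]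
        exact (min_le_left _ _).trans (le_abs_self _)
  have hp1 : 1 ≤ p := by
    rcases min_le_iff.1 hδ with h1 | h1 <;> nlinarith
  have hμx : μ {x} = 1 := by
    refine le_antisymm prob_le_one ?_
    rwa [← ENNReal.ofReal_one, ENNReal.ofReal_le_iff_le_toReal (measure_ne_top _ _)]
  have hae : ∀ᵐ z ∂μ, z = x := (prob_compl_eq_zero_iff (measurableSet_singleton x)).2 hμx
  have h1 := hμ (Finsupp.single 0 1)
  rw [integral_congr_ae (g := fun _ => (x 0 : ℂ))
    (hae.mono fun z hz => by simp only [torusChar_single, hz]), integral_const] at h1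
  have h2 := congrArg norm h1
  rw [Complex.norm_real, Real.norm_of_nonneg (Real.exp_pos _).le] at h2
  simp [covForm, hr0] at h2
  norm_num at h2
  rw [Circle.norm_coe] at h2
  exact ((Real.exp_lt_one_iff (x := -(1 / 2))).2 (by norm_num)).ne' h2

/-- A measure-preserving transformation of `[0,1]` with prescribed mixing and rigidity. -/
lemma exists_aut01_of_posDefSeq (hrp : PosDefSeq r) (hr0 : r 0 = 1)
    (h : ∀ l, AvgNull (fun M : ℕ => Finset.Icc (1 : ℤ) M) atTop fun n => r (n + l)) :
    ∃ T : Aut01, T.WeaklyMixing ∧ ∀ x : ℕ → ℤ, ∀ A B : Set unitInterval,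
      MeasurableSet A → MeasurableSet B →
      ((∀ l, Tendsto (fun k => r (x k + l)) atTop (𝓝 (r l))) →
        Tendsto (fun k => T.corr (x k) A B) atTop (𝓝 (volume (A ∩ B)).toReal)) ∧
      ((∀ l, Tendsto (fun k => r (x k + l)) atTop (𝓝 0)) →
        Tendsto (fun k => T.corr (x k) A B) atTop
          (𝓝 ((volume A).toReal * (volume B).toReal))) := by
  obtain ⟨μ, hprob, hμ⟩ := exists_torus_measure hrp
  have hr := hrp.even
  have hr1 : ∀ m, |r m| ≤ 1 := fun m => hr0 ▸ hrp.abs_le m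
  have : NullSingletonClass μ := ⟨measure_singleton_eq_zero hμ hr hr1 hr0 h⟩
  obtain ⟨T, j, hj, hT⟩ := exists_aut01_of_perm μ torusShift
    (by simpa using measurePreserving_torusShift_zpow hμ 1)
    (by simpa using measurePreserving_torusShift_zpow hμ (-1))
  have hvol : ∀ {A : Set unitInterval}, MeasurableSet A → (volume A).toReal = μ.real (j ⁻¹' A) :=
    fun hA => by rw [Measure.real, hj.measure_preimage hA.nullMeasurableSet]
  refine ⟨T, fun A B hA hB => ?_, fun x A B hA hB => ⟨fun hx => ?_, fun hx => ?_⟩⟩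
  · refine (avgNull_corr_mixing hμ hr hr1 h (hj.measurable hA) (hj.measurable hB)).congr
      fun M => ?_
    simp only [hT _ A B hA hB, hvol hA, hvol hB]
    have himage : (Finset.Icc 1 M).image ((↑) : ℕ → ℤ) = Finset.Icc (1 : ℤ) M := by
      rw [← Finset.coe_inj, Finset.coe_image, Finset.coe_Icc, Nat.image_cast_int_Icc]
      simp
    rw [← himage, Finset.sum_image fun _ _ _ _ hab => Nat.cast_injective hab,
      Finset.card_image_of_injective _ Nat.cast_injective, Nat.card_Icc, Nat.add_sub_cancel,
      one_div]
  · have := avgNull_singleton_iff.1 (avgNull_corr_rigid hμ hr hr1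
      (fun l => avgNull_singleton_iff.2 (by simpa using (hx l).sub_const (r l)))
      (hj.measurable hA) (hj.measurable hB))
    simp only [hT _ A B hA hB, hvol (hA.inter hB), Set.preimage_inter]
    simpa using this.add_const (μ.real (j ⁻¹' A ∩ j ⁻¹' B))
  · have := avgNull_singleton_iff.1 (avgNull_corr_mixing hμ hr hr1
      (fun l => avgNull_singleton_iff.2 (hx l)) (hj.measurable hA) (hj.measurable hB))
    simp only [hT _ A B hA hB, hvol hA, hvol hB]
    simpa using this.add_const (μ.real (j ⁻¹' A) * μ.real (j ⁻¹' B))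

end Assembly

/-- For asymptotically linearly independent `φ_1,…,φ_N : ℕ → ℤ` there
is a strictly increasing `(n_k)` such that for every `ξ ∈ {0,1}^N` there is a weakly
mixing `T_ξ ∈ Aut([0,1],ℬ,μ)` with
`μ(A ∩ T_ξ^{-φ_j(n_k)}B) → (1-ξ_j)μ(A∩B) + ξ_j μ(A)μ(B)` for all `j` and all
measurable `A,B`. -/
theorem stmt_4 (N : ℕ) (φ : Fin N → ℕ → ℤ)
    (hφ : ∀ a : Fin N → ℤ, a ≠ 0 →
      Tendsto (fun n => |∑ j, a j * φ j n|) atTop atTop) :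
    ∃ n : ℕ → ℕ, StrictMono n ∧
      ∀ ξ : Fin N → ℝ, (∀ j, ξ j = 0 ∨ ξ j = 1) →
        ∃ T : Aut01, T.WeaklyMixing ∧
          ∀ j : Fin N, ∀ A B : Set unitInterval, MeasurableSet A → MeasurableSet B →
            Tendsto (fun k => T.corr (φ j (n k)) A B) atTop
              (𝓝 ((1 - ξ j) * (volume (A ∩ B)).toReal
                + ξ j * (volume A).toReal * (volume B).toReal)) := by
  obtain ⟨n, L, hn, hL⟩ := exists_separated φ hφ
  refine ⟨n, hn, fun ξ hξ => ?_⟩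
  classical
  let Z : Finset (Fin N) := Finset.univ.filter fun j => ξ j = 0
  obtain ⟨T, hT, hcorr⟩ := exists_aut01_of_posDefSeq (posDefSeq_limitCov Z hL)
    (limitCov_zero Z hL) (avgNull_limitCov Z hL)
  refine ⟨T, hT, fun j A B hA hB => ?_⟩
  have h := tendsto_limitCov Z hL j
  rcases hξ j with hj | hj
  · have hjZ : j ∈ Z := by simp [Z, hj]
    simpa [hj] using (hcorr _ A B hA hB).1 (by simpa only [if_pos hjZ] using h)
  · have hjZ : j ∉ Z := by simp [Z, hj]
    simpa [hj] using (hcorr _ A B hA hB).2 (by simpa only [if_neg hjZ] using h)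
end
end
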